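/- arXiv:0808.0415 — 4 statements merged into one kernel-verified Lean document; each statement's English description precedes it below -/
import Mathlib

section
/- Let f : ℂ → ℂ be continuously differentiable with compact support contained in the open unit disk D. Then for every z ∈ D one has f(z) = -(1/π) ∫_{w ∈ D} (∂̄f)(w)/(w − z) dA(w). (In the paper's notation: P ∘ ∂̄ = Id on compactly supported functions, part 1 of Theorem 2.1.) -/
open MeasureTheory

/-- The Cauchy–Green operator on the unit disk. -/
noncomputable def cauchyGreen (f : ℂ → ℂ) (z : ℂ) : ℂ :=
  -(1 / (Real.pi : ℂ)) * ∫ w in Metric.ball (0 : ℂ) 1, f w / (w - z)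

/-- The Cauchy–Riemann operator `∂̄f = ½(∂f/∂x + i ∂f/∂y)`. -/
noncomputable def dbar (g : ℂ → ℂ) (z : ℂ) : ℂ :=
  (1 / 2 : ℂ) * (fderiv ℝ g z 1 + Complex.I * fderiv ℝ g z Complex.I)

theorem dbar_eq_zero_of_notMem_tsupport {f : ℂ → ℂ} {w : ℂ} (hw : w ∉ tsupport f) :
    dbar f w = 0 := by
  simp [dbar, fderiv_of_notMem_tsupport ℝ hw]

/-- The Cauchy–Riemann operator in polar directions. -/
theorem two_mul_exp_neg_mul_dbar (f : ℂ → ℂ) (w : ℂ) (θ : ℝ) :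
    2 * (Complex.exp (-(θ * Complex.I)) * dbar f w) =
      fderiv ℝ f w (Complex.exp (θ * Complex.I)) +
        Complex.I * fderiv ℝ f w (Complex.I * Complex.exp (θ * Complex.I)) := by
  have hre : Complex.exp (θ * Complex.I) =
      Real.cos θ • (1 : ℂ) + Real.sin θ • Complex.I := by
    simp [Complex.exp_mul_I]
  have him : Complex.I * Complex.exp (θ * Complex.I) =
      Real.cos θ • Complex.I - Real.sin θ • (1 : ℂ) := by
    simp only [hre, Complex.real_smul]
    linear_combination (Real.sin θ : ℂ) * Complex.I_mul_I
  have hneg : Complex.exp (-(θ * Complex.I)) = Real.cos θ - Real.sin θ * Complex.I := by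
    rw [← neg_mul, Complex.exp_mul_I]
    simp [sub_eq_add_neg]
  rw [him, hre, hneg, map_add, map_sub, map_smul, map_smul, map_smul, map_smul]
  simp only [Complex.real_smul, dbar]
  linear_combination
    -(Real.sin θ : ℂ) * fderiv ℝ f w Complex.I * Complex.I_mul_I

theorem integrableOn_Ioi_prod_Ioo_of_eq_zero {E : Type*} [NormedAddCommGroup E] {K : ℝ × ℝ → E}
    {R a b : ℝ} (hK : Continuous K) (hR : ∀ p : ℝ × ℝ, R < p.1 → K p = 0) :
    IntegrableOn K (Set.Ioi 0 ×ˢ Set.Ioo a b) := by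
  have hc : IntegrableOn K (Set.Icc 0 R ×ˢ Set.Icc a b) :=
    hK.continuousOn.integrableOn_compact (isCompact_Icc.prod isCompact_Icc)
  refine hc.of_forall_sdiff_eq_zero (measurableSet_Ioi.prod measurableSet_Ioo) ?_
  rintro ⟨r, θ⟩ ⟨⟨hr, hθ⟩, hn⟩
  refine hR _ (lt_of_not_ge fun h => hn ⟨⟨le_of_lt hr, h⟩, hθ.1.le, hθ.2.le⟩)

theorem integral_Ioi_fderiv_ray {f : ℂ → ℂ} (hf : ContDiff ℝ 1 f) (hcs : HasCompactSupport f)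
    (z : ℂ) {e : ℂ} (he : ‖e‖ = 1) :
    ∫ r in Set.Ioi (0 : ℝ), fderiv ℝ f (z + r * e) e = -f z := by
  have hd (r : ℝ) : HasDerivAt (fun r : ℝ => f (z + r * e)) (fderiv ℝ f (z + r * e) e) r := by
    have h : HasDerivAt (fun r : ℝ => z + r * e) e r := by
      simpa using ((Complex.ofRealCLM.hasDerivAt (x := r)).mul_const e).const_add z
    exact (hf.differentiable one_ne_zero _).hasFDerivAt.comp_hasDerivAt r h
  have hs : HasCompactSupport (fun r : ℝ => f (z + r * e)) := by
    refine hcs.comp_isClosedEmbedding (Isometry.isClosedEmbedding ?_)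
    refine Isometry.of_dist_eq fun r s => ?_
    rw [dist_add_left, dist_eq_norm, ← sub_mul, norm_mul, he, mul_one, ← Complex.ofReal_sub,
      Complex.norm_real, dist_eq_norm]
  have hc : ContDiff ℝ 1 (fun r : ℝ => f (z + r * e)) :=
    hf.comp (contDiff_const.add (Complex.ofRealCLM.contDiff.mul contDiff_const))
  have := hs.integral_Ioi_deriv_eq hc 0
  simpa [fun r => (hd r).deriv] using this

theorem integral_Ioo_fderiv_circle {f : ℂ → ℂ} (hf : ContDiff ℝ 1 f) (z : ℂ) {r : ℝ}
    (hr : r ≠ 0) :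
    ∫ θ in Set.Ioo (-Real.pi) Real.pi,
      fderiv ℝ f (z + r * Complex.exp (θ * Complex.I))
        (Complex.I * Complex.exp (θ * Complex.I)) = 0 := by
  have hd (θ : ℝ) : HasDerivAt (fun θ : ℝ => (r : ℂ)⁻¹ * f (z + r * Complex.exp (θ * Complex.I)))
      (fderiv ℝ f (z + r * Complex.exp (θ * Complex.I))
        (Complex.I * Complex.exp (θ * Complex.I))) θ := by
    have h : HasDerivAt (fun θ : ℝ => z + r * Complex.exp (θ * Complex.I))
        (r • (Complex.I * Complex.exp (θ * Complex.I))) θ := by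
      have := (((Complex.ofRealCLM.hasDerivAt (x := θ)).mul_const Complex.I).cexp.const_mul
        (r : ℂ)).const_add z
      simpa [mul_comm, mul_left_comm, mul_assoc] using this
    have := ((hf.differentiable one_ne_zero _).hasFDerivAt.comp_hasDerivAt θ h).const_mul
      ((r : ℂ)⁻¹)
    rwa [map_smul, Complex.real_smul, inv_mul_cancel_left₀ (by exact_mod_cast hr)] at this
  have hcont : Continuous fun θ : ℝ => fderiv ℝ f (z + r * Complex.exp (θ * Complex.I))
      (Complex.I * Complex.exp (θ * Complex.I)) :=
    ((hf.continuous_fderiv one_ne_zero).comp (by fun_prop)).clm_apply (by fun_prop)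
  rw [← integral_Ioc_eq_integral_Ioo,
    ← intervalIntegral.integral_of_le (by linarith [Real.pi_pos]),
    intervalIntegral.integral_eq_sub_of_hasDerivAt (fun θ _ => hd θ)
      (hcont.intervalIntegrable _ _)]
  simp [Complex.exp_neg, Complex.exp_pi_mul_I]

/-- **Cauchy–Pompeiu formula** on the plane for compactly supported functions. -/
theorem integral_dbar_div_sub {f : ℂ → ℂ} (hf : ContDiff ℝ 1 f) (hcs : HasCompactSupport f)
    (z : ℂ) : ∫ w, dbar f w / (w - z) = -(Real.pi * f z) := by
  let e : ℝ → ℂ := fun θ => Complex.exp (θ * Complex.I)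
  let T : Set (ℝ × ℝ) := Set.Ioi 0 ×ˢ Set.Ioo (-Real.pi) Real.pi
  let A : ℝ × ℝ → ℂ := fun p => fderiv ℝ f (z + p.1 * e p.2) (e p.2)
  let B : ℝ × ℝ → ℂ := fun p => fderiv ℝ f (z + p.1 * e p.2) (Complex.I * e p.2)
  have he (θ : ℝ) : ‖e θ‖ = 1 := Complex.norm_exp_ofReal_mul_I θ
  obtain ⟨R, hR⟩ := hcs.isCompact.isBounded.subset_closedBall z
  have hzero (p : ℝ × ℝ) (hp : R < p.1) : fderiv ℝ f (z + p.1 * e p.2) = 0 := by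
    refine fderiv_of_notMem_tsupport ℝ fun hmem => ?_
    have := hR hmem
    rw [Metric.mem_closedBall, dist_self_add_left, norm_mul, he, mul_one, Complex.norm_real] at this
    exact absurd (this.trans_lt hp) (not_lt.2 (le_abs_self _))
  have hfd : Continuous fun p : ℝ × ℝ => fderiv ℝ f (z + p.1 * e p.2) :=
    (hf.continuous_fderiv one_ne_zero).comp (by fun_prop)
  have hA : IntegrableOn A T :=
    integrableOn_Ioi_prod_Ioo_of_eq_zero (R := R) (hfd.clm_apply (by fun_prop))
      fun p hp => by simp [A, hzero p hp]
  have hB : IntegrableOn B T :=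
    integrableOn_Ioi_prod_Ioo_of_eq_zero (R := R) (hfd.clm_apply (by fun_prop))
      fun p hp => by simp [B, hzero p hp]
  have hIA : ∫ p in T, A p = -(2 * Real.pi * f z) := by
    rw [Measure.volume_eq_prod, ← setIntegral_prod_swap, setIntegral_prod (fun q => A q.swap) hA.swap]
    simp only [Prod.swap_prod_mk, A, integral_Ioi_fderiv_ray hf hcs z (he _)]
    rw [setIntegral_const, Real.volume_real_Ioo_of_le (by linarith [Real.pi_pos]),
      Complex.real_smul]
    push_cast
    ring
  have hIB : ∫ p in T, B p = 0 := by
    rw [Measure.volume_eq_prod, setIntegral_prod _ hB]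
    exact setIntegral_eq_zero_of_forall_eq_zero fun r hr =>
      integral_Ioo_fderiv_circle hf z (ne_of_gt hr)
  have hpolar : ∫ w, dbar f w / (w - z) = ∫ p in T, (1 / 2 : ℂ) * (A p + Complex.I * B p) := by
    rw [← integral_add_left_eq_self _ z, ← Complex.integral_comp_polarCoord_symm]
    refine setIntegral_congr_fun (measurableSet_Ioi.prod measurableSet_Ioo) ?_
    rintro ⟨r, θ⟩ ⟨hr, -⟩
    have hr0 : (r : ℂ) ≠ 0 := by exact_mod_cast ne_of_gt hr
    have hsymm : Complex.polarCoord.symm (r, θ) = r * e θ := by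
      simp [e, Complex.exp_mul_I]
    have := two_mul_exp_neg_mul_dbar f (z + r * e θ) θ
    simp only [hsymm, A, B, add_sub_cancel_left, Complex.real_smul, e] at this ⊢
    rw [← this, Complex.exp_neg]
    field_simp
  rw [hpolar, integral_const_mul, integral_add hA (hB.const_mul _), integral_const_mul, hIA, hIB]
  ring

/-- `P ∘ ∂̄ = Id` on continuously differentiable functions with
compact support contained in the open unit disk. -/
theorem cauchyGreen_dbar_eq_self (f : ℂ → ℂ) (hf : ContDiff ℝ 1 f)
    (hcs : HasCompactSupport f)
    (hsupp : tsupport f ⊆ Metric.ball (0 : ℂ) 1) :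
    ∀ z ∈ Metric.ball (0 : ℂ) 1, f z = cauchyGreen (dbar f) z := by
  intro z _
  rw [cauchyGreen, setIntegral_eq_integral_of_forall_compl_eq_zero fun w hw => by
    rw [dbar_eq_zero_of_notMem_tsupport fun h => hw (hsupp h), zero_div],
    integral_dbar_div_sub hf hcs]
  have : (Real.pi : ℂ) ≠ 0 := by exact_mod_cast Real.pi_ne_zero
  field_simp
end

section
/- Let α ∈ (0,1) and let f : ℂ → ℂ be bounded, vanish outside the closed unit disk, and be α-Hölder continuous. Then Pf is real-differentiable at every point z of the open unit disk D and satisfies ∂̄(Pf)(z) = f(z). (Part of Theorem 2.1: P is a right inverse of the Cauchy–Riemann operator on Hölder functions.) -/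
open MeasureTheory

open Metric Filter Topology Set in
theorem integrableOn_norm_sub_rpow {p : ℝ} (hp : -2 < p) (a : ℂ) {s : Set ℂ}
    (hs : Bornology.IsBounded s) : IntegrableOn (fun w : ℂ => ‖w - a‖ ^ p) s := by
  obtain ⟨R, hR⟩ := hs.subset_closedBall a
  refine IntegrableOn.mono_set ?_ hR
  have hloc : LocallyIntegrable (fun w : ℂ => ‖w‖ ^ p) := by
    refine locallyIntegrable_of_norm_le_rpow (C := 1) (α := -p) (by simp) ?_ ?_ ?_
    · rw [Complex.finrank_real_complex]; push_cast; linarith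
    · filter_upwards with w
      rw [Real.norm_of_nonneg (by positivity), neg_neg, one_mul]
    · exact (measurable_norm.pow_const p).aestronglyMeasurable
  have h := (integrable_indicator_iff measurableSet_closedBall).2
    (hloc.integrableOn_isCompact (isCompact_closedBall (0 : ℂ) R))
  rw [← integrable_indicator_iff measurableSet_closedBall]
  refine (h.comp_sub_right a).congr (.of_forall fun w => ?_)
  simp [indicator, dist_eq_norm]

open Metric Filter Topology Set in
theorem setIntegral_ball_inv_norm_sub (z : ℂ) {r : ℝ} (hr : 0 ≤ r) :
    ∫ w in ball z r, ‖w - z‖⁻¹ = 2 * Real.pi * r := by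
  have h : ∀ w : ℂ, (ball z r).indicator (fun w => ‖w - z‖⁻¹) w =
      (Iio r).indicator (fun y : ℝ => y⁻¹) ‖w - z‖ := by
    intro w
    simp [indicator, dist_eq_norm]
  rw [← integral_indicator measurableSet_ball, integral_congr_ae (.of_forall h),
    integral_sub_right_eq_self (fun w : ℂ => (Iio r).indicator (fun y : ℝ => y⁻¹) ‖w‖) z,
    integral_fun_norm_addHaar]
  have h2 : ∀ y ∈ Ioi (0 : ℝ), y ^ (Module.finrank ℝ ℂ - 1) • (Iio r).indicator (fun y : ℝ => y⁻¹) y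
      = (Iio r).indicator (fun _ => (1 : ℝ)) y := by
    intro y hy
    by_cases hyr : y < r
    · simp [hyr, (mem_Ioi.1 hy).ne', Complex.finrank_real_complex]
    · simp [hyr]
  rw [setIntegral_congr_fun measurableSet_Ioi h2, setIntegral_indicator measurableSet_Iio,
    Ioi_inter_Iio]
  simp [Complex.finrank_real_complex, Measure.real, hr]
  ring

theorem norm_sub_rpow_div_le_of_far (p : ℝ) {a z w : ℂ} (hw : ‖z - a‖ / 2 ≤ ‖w - z‖) :
    ‖z - a‖ * ‖w - a‖ ^ p / ‖w - z‖ ≤ 2 * ‖w - a‖ ^ p := by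
  have h0 : 0 ≤ ‖w - a‖ ^ p := by positivity
  refine div_le_of_le_mul₀ (norm_nonneg _) (by positivity) ?_
  nlinarith

theorem norm_sub_rpow_div_le_of_near {p : ℝ} (hp0 : p ≤ 0) {a z w : ℂ}
    (hw : ‖w - z‖ < ‖z - a‖ / 2) :
    ‖z - a‖ * ‖w - a‖ ^ p / ‖w - z‖ ≤ (‖z - a‖ * (‖z - a‖ / 2) ^ p) * ‖w - z‖⁻¹ := by
  have htri : ‖z - a‖ ≤ ‖w - a‖ + ‖w - z‖ := by
    simpa using norm_sub_le (w - a) (w - z)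
  have hpos : 0 < ‖z - a‖ / 2 := (norm_nonneg _).trans_lt hw
  have hle : ‖w - a‖ ^ p ≤ (‖z - a‖ / 2) ^ p :=
    Real.rpow_le_rpow_of_nonpos hpos (by linarith) hp0
  rw [div_eq_mul_inv]
  gcongr

theorem integrableOn_inv_norm_sub (z : ℂ) {s : Set ℂ} (hs : Bornology.IsBounded s) :
    IntegrableOn (fun w : ℂ => ‖w - z‖⁻¹) s := by
  simpa only [Real.rpow_neg_one] using
    integrableOn_norm_sub_rpow (p := -1) (by norm_num) z hs

theorem integrableOn_norm_sub_rpow_div {p : ℝ} (hp : -2 < p) (hp0 : p ≤ 0) (a z : ℂ)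
    {s : Set ℂ} (hs : Bornology.IsBounded s) :
    IntegrableOn (fun w => ‖z - a‖ * ‖w - a‖ ^ p / ‖w - z‖) s := by
  refine (((integrableOn_norm_sub_rpow hp a hs).const_mul 2).add
    ((integrableOn_inv_norm_sub z hs).const_mul (‖z - a‖ * (‖z - a‖ / 2) ^ p))).mono'
    (((((measurable_id.sub_const a).norm).pow_const p).const_mul _).div
      ((measurable_id.sub_const z).norm)).aestronglyMeasurable (.of_forall fun w => ?_)
  rw [Real.norm_of_nonneg (by positivity)]
  rcases le_or_gt (‖z - a‖ / 2) ‖w - z‖ with h | h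
  · exact (norm_sub_rpow_div_le_of_far p h).trans (le_add_of_nonneg_right (by positivity))
  · exact (norm_sub_rpow_div_le_of_near hp0 h).trans (le_add_of_nonneg_left (by positivity))

open Metric Filter Topology Set in
theorem tendsto_setIntegral_norm_sub_rpow_div {p : ℝ} (hp : -2 < p) (hp0 : p ≤ 0) (a : ℂ)
    {s : Set ℂ} (hs : Bornology.IsBounded s) :
    Tendsto (fun z => ∫ w in s, ‖z - a‖ * ‖w - a‖ ^ p / ‖w - z‖) (𝓝[≠] a) (𝓝 0) := by
  set K : ℂ → ℂ → ℝ := fun z w => ‖z - a‖ * ‖w - a‖ ^ p / ‖w - z‖ with hK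
  set K₁ : ℂ → ℂ → ℝ := fun z => (ball z (‖z - a‖ / 2))ᶜ.indicator (K z) with hK₁
  set K₂ : ℂ → ℂ → ℝ := fun z => (ball z (‖z - a‖ / 2)).indicator
    (fun w => (‖z - a‖ * (‖z - a‖ / 2) ^ p) * ‖w - z‖⁻¹) with hK₂
  have hKnn : ∀ z w, 0 ≤ K z w := fun z w => by positivity
  have hK₁nn : ∀ z w, 0 ≤ K₁ z w := fun z w => indicator_nonneg (fun w _ => hKnn z w) w
  have hKm : ∀ z, Measurable (K z) := fun z =>
    ((((measurable_id.sub_const a).norm).pow_const p).const_mul _).div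
      ((measurable_id.sub_const z).norm)
  have hK₁m : ∀ z, Measurable (K₁ z) := fun z => (hKm z).indicator measurableSet_ball.compl
  have hK₁b : ∀ z w, K₁ z w ≤ 2 * ‖w - a‖ ^ p := by
    intro z w
    have h0 : 0 ≤ ‖w - a‖ ^ p := by positivity
    refine indicator_apply_le' (fun hw => ?_) (fun _ => by positivity)
    exact norm_sub_rpow_div_le_of_far p (by simpa [dist_eq_norm] using hw)
  have hInt : IntegrableOn (fun w => 2 * ‖w - a‖ ^ p) s :=
    (integrableOn_norm_sub_rpow hp a hs).const_mul 2
  have hK₁i : ∀ z, IntegrableOn (K₁ z) s := fun z =>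
    hInt.mono' (hK₁m z).aestronglyMeasurable
      (.of_forall fun w => by rw [Real.norm_of_nonneg (hK₁nn z w)]; exact hK₁b z w)
  have hK₂i : ∀ z, Integrable (K₂ z) := by
    intro z
    rw [hK₂, integrable_indicator_iff measurableSet_ball]
    exact (integrableOn_inv_norm_sub z isBounded_ball).const_mul _
  have hlim₁ : Tendsto (fun z => ∫ w in s, K₁ z w) (𝓝[≠] a) (𝓝 0) := by
    have := tendsto_integral_filter_of_dominated_convergence (μ := volume.restrict s)
      (l := 𝓝[≠] a) (F := K₁) (f := fun _ => (0 : ℝ)) (fun w => 2 * ‖w - a‖ ^ p)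
      (.of_forall fun z => (hK₁m z).aestronglyMeasurable)
      (.of_forall fun z => .of_forall fun w => by
        rw [Real.norm_of_nonneg (hK₁nn z w)]; exact hK₁b z w) hInt ?_
    · simpa using this
    · have hne : ∀ᵐ w ∂(volume.restrict s), w ≠ a :=
        ae_restrict_of_ae (Measure.ae_ne volume a)
      filter_upwards [hne] with w hw
      have hc : Tendsto (fun z => K z w) (𝓝 a) (𝓝 (K a w)) := by
        have : ‖w - a‖ ≠ 0 := norm_ne_zero_iff.2 (sub_ne_zero.2 hw)
        refine ContinuousAt.tendsto (f := fun z => ‖z - a‖ * ‖w - a‖ ^ p / ‖w - z‖) ?_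
        fun_prop (disch := assumption)
      have hz : K a w = 0 := by simp [hK]
      rw [hz] at hc
      exact squeeze_zero (fun z => hK₁nn z w)
        (fun z => indicator_le_self' (fun w _ => hKnn z w) w) (hc.mono_left nhdsWithin_le_nhds)
  have hbound₂ : ∀ z, z ≠ a → ∫ w in s, K₂ z w ≤
      2 * Real.pi * 2 * (‖z - a‖ / 2) ^ (p + 2) := by
    intro z hz
    have hpos : 0 < ‖z - a‖ / 2 := by
      have := norm_pos_iff.2 (sub_ne_zero.2 hz); positivity
    calc ∫ w in s, K₂ z w ≤ ∫ w, K₂ z w :=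
          setIntegral_le_integral (hK₂i z) (.of_forall fun w => indicator_nonneg
            (fun w _ => by positivity) w)
      _ = (‖z - a‖ * (‖z - a‖ / 2) ^ p) * (2 * Real.pi * (‖z - a‖ / 2)) := by
          rw [hK₂, integral_indicator measurableSet_ball, integral_const_mul,
            setIntegral_ball_inv_norm_sub z hpos.le]
      _ = 2 * Real.pi * 2 * (‖z - a‖ / 2) ^ (p + 2) := by
          rw [Real.rpow_add hpos, Real.rpow_two]; ring
  have hlim₂ : Tendsto (fun z => 2 * Real.pi * 2 * (‖z - a‖ / 2) ^ (p + 2)) (𝓝[≠] a) (𝓝 0) := by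
    have hc : Continuous fun z : ℂ => 2 * Real.pi * 2 * (‖z - a‖ / 2) ^ (p + 2) :=
      continuous_const.mul (((continuous_id.sub continuous_const).norm.div_const 2).rpow_const
        fun _ => Or.inr (by linarith))
    have := (hc.tendsto a).mono_left (nhdsWithin_le_nhds (s := {a}ᶜ))
    have hne : p + 2 ≠ 0 := by linarith
    simpa [Real.zero_rpow hne] using this
  have hsum := hlim₁.add hlim₂
  rw [add_zero] at hsum
  refine squeeze_zero' (.of_forall fun z => integral_nonneg fun w => hKnn z w) ?_ hsum
  filter_upwards [self_mem_nhdsWithin] with z hz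
  calc ∫ w in s, K z w ≤ ∫ w in s, (K₁ z w + K₂ z w) := by
        refine integral_mono_of_nonneg (.of_forall fun w => hKnn z w)
          ((hK₁i z).add (hK₂i z).integrableOn) (.of_forall fun w => ?_)
        by_cases hw : w ∈ ball z (‖z - a‖ / 2)
        · simp only [hK₁, hK₂, indicator_of_mem hw, indicator_of_notMem (notMem_compl_iff.2 hw),
            zero_add, hK]
          exact norm_sub_rpow_div_le_of_near hp0 (by simpa [dist_eq_norm] using hw)
        · simp only [hK₁, hK₂, indicator_of_notMem hw, indicator_of_mem (mem_compl hw), add_zero,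
            le_refl]
    _ = (∫ w in s, K₁ z w) + ∫ w in s, K₂ z w := integral_add (hK₁i z) (hK₂i z).integrableOn
    _ ≤ _ := by gcongr; exact hbound₂ z hz

theorem integrableOn_div_sub {g : ℂ → ℂ} (hgm : AEStronglyMeasurable g) {M : ℝ}
    (hM : ∀ w, ‖g w‖ ≤ M) (z : ℂ) {s : Set ℂ} (hs : Bornology.IsBounded s) :
    IntegrableOn (fun w => g w / (w - z)) s := by
  simp only [div_eq_mul_inv]
  refine ((integrableOn_inv_norm_sub z hs).const_mul M).mono'
    (hgm.restrict.mul (measurable_id.sub_const z).inv.aestronglyMeasurable)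
    (.of_forall fun w => ?_)
  rw [norm_mul, norm_inv]
  gcongr
  exact hM w

open Filter Topology in
theorem hasDerivAt_setIntegral_div_sub {g : ℂ → ℂ} (hgm : AEStronglyMeasurable g) {M : ℝ}
    (hM : ∀ w, ‖g w‖ ≤ M) {α C : ℝ} (hα : 0 < α) (hα2 : α ≤ 2) {a : ℂ}
    (hg : ∀ w, ‖g w‖ ≤ C * ‖w - a‖ ^ α) {s : Set ℂ} (hs : Bornology.IsBounded s) :
    HasDerivAt (fun z => ∫ w in s, g w / (w - z)) (∫ w in s, g w / (w - a) ^ 2) a := by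
  have hgp : ∀ w, w ≠ a → ‖g w‖ / ‖w - a‖ ^ 2 ≤ C * ‖w - a‖ ^ (α - 2) := by
    intro w hw
    have hpos : 0 < ‖w - a‖ := norm_pos_iff.2 (sub_ne_zero.2 hw)
    rw [Real.rpow_sub hpos, Real.rpow_two, ← mul_div_assoc]
    gcongr
    exact hg w
  have hne : ∀ z : ℂ, ∀ᵐ w ∂(volume.restrict s), w ≠ z := fun z =>
    ae_restrict_of_ae (Measure.ae_ne volume z)
  have hInt : IntegrableOn (fun w => g w / (w - a) ^ 2) s := by
    simp only [div_eq_mul_inv]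
    refine ((integrableOn_norm_sub_rpow (p := α - 2) (by linarith) a hs).const_mul C).mono'
      (hgm.restrict.mul ((measurable_id.sub_const a).pow_const 2).inv.aestronglyMeasurable) ?_
    filter_upwards [hne a] with w hw
    rw [norm_mul, norm_inv, norm_pow, ← div_eq_mul_inv]
    exact hgp w hw
  rw [hasDerivAt_iff_tendsto_slope, tendsto_iff_norm_sub_tendsto_zero]
  have hlim := (tendsto_setIntegral_norm_sub_rpow_div (p := α - 2) (by linarith) (by linarith) a
    hs).const_mul C
  rw [mul_zero] at hlim
  refine squeeze_zero' (.of_forall fun z => norm_nonneg _) ?_ hlim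
  filter_upwards [self_mem_nhdsWithin] with z hz
  have hza : z - a ≠ 0 := sub_ne_zero.2 hz
  have hiz := integrableOn_div_sub hgm hM z hs
  have hia := integrableOn_div_sub hgm hM a hs
  have heq : slope (fun z => ∫ w in s, g w / (w - z)) a z - ∫ w in s, g w / (w - a) ^ 2 =
      ∫ w in s, ((z - a)⁻¹ * (g w / (w - z) - g w / (w - a)) - g w / (w - a) ^ 2) := by
    have hi : IntegrableOn (fun w => (z - a)⁻¹ * (g w / (w - z) - g w / (w - a))) s :=
      (hiz.sub hia).const_mul _
    rw [integral_sub hi hInt, integral_const_mul, integral_sub hiz hia,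
      slope_def_module, smul_eq_mul]
  rw [heq, ← integral_const_mul]
  refine norm_integral_le_of_norm_le
    ((integrableOn_norm_sub_rpow_div (by linarith) (by linarith) a z hs).const_mul C) ?_
  filter_upwards [hne a, hne z] with w hwa hwz
  have h1 : w - a ≠ 0 := sub_ne_zero.2 hwa
  have h2 : w - z ≠ 0 := sub_ne_zero.2 hwz
  have h3 : (z - a)⁻¹ * (g w / (w - z) - g w / (w - a)) - g w / (w - a) ^ 2 =
      (g w / (w - a) ^ 2) * ((z - a) / (w - z)) := by
    field_simp
    ring
  rw [h3, norm_mul, norm_div, norm_div, norm_pow]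
  calc _ ≤ C * ‖w - a‖ ^ (α - 2) * (‖z - a‖ / ‖w - z‖) := by gcongr; exact hgp w hwa
    _ = _ := by ring

open Metric in
theorem circleAverage_inv_sub_of_lt_norm {z : ℂ} {r : ℝ} (hr : 0 < r) (h : r < ‖z‖) :
    Real.circleAverage (fun w => (w - z)⁻¹) 0 r = -z⁻¹ := by
  have hd : DifferentiableOn ℂ (fun w => (w - z)⁻¹) (closedBall 0 |r|) := by
    refine DifferentiableOn.inv (by fun_prop) fun w hw => sub_ne_zero.2 ?_
    rintro rfl
    rw [mem_closedBall_zero_iff, abs_of_pos hr] at hw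
    linarith
  rw [(hd.diffContOnCl_ball subset_rfl).circleAverage]
  simp [inv_neg]

open Metric ComplexConjugate in
theorem circleAverage_inv_sub_of_norm_lt {z : ℂ} {r : ℝ} (h : ‖z‖ < r) :
    Real.circleAverage (fun w => (w - z)⁻¹) 0 r = 0 := by
  have hr : 0 < r := (norm_nonneg _).trans_lt h
  have hne : ∀ w ∈ closedBall (0 : ℂ) |r|, (r : ℂ) ^ 2 - conj z * w ≠ 0 := by
    intro w hw h0
    rw [mem_closedBall_zero_iff, abs_of_pos hr] at hw
    have : ‖(r : ℂ) ^ 2‖ = ‖conj z * w‖ := by rw [sub_eq_zero.1 h0]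
    rw [norm_mul, norm_pow, Complex.norm_real, Real.norm_of_nonneg hr.le, RCLike.norm_conj] at this
    nlinarith [norm_nonneg z, norm_nonneg w]
  set F : ℂ → ℂ := fun w => w / ((r : ℂ) ^ 2 - conj z * w) with hF
  have hd : DifferentiableOn ℂ F (closedBall 0 |r|) :=
    DifferentiableOn.div (by fun_prop) (by fun_prop) hne
  have heq : Set.EqOn (fun w => (w - z)⁻¹) (Complex.conjCLE.toContinuousLinearMap ∘ F)
      (sphere 0 |r|) := by
    intro w hw
    have hn := hne w (sphere_subset_closedBall hw)
    rw [mem_sphere_zero_iff_norm, abs_of_pos hr] at hw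
    have hww : w * conj w = (r : ℂ) ^ 2 := by rw [Complex.mul_conj']; simp [hw]
    have hcn : (r : ℂ) ^ 2 - z * conj w ≠ 0 := by
      have := (map_ne_zero (starRingEnd ℂ)).2 hn
      simpa using this
    have hwz : w - z ≠ 0 := by
      intro h0
      rw [sub_eq_zero.1 h0] at hw
      linarith
    simp only [Function.comp, hF, ContinuousLinearEquiv.coe_coe, Complex.conjCLE_apply, map_div₀,
      map_sub, map_pow, map_mul, Complex.conj_ofReal, Complex.conj_conj]
    rw [inv_eq_iff_eq_inv, inv_div, eq_div_iff]
    · rw [← hww]; ring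
    · intro h0
      rw [h0, mul_zero] at hww
      exact pow_ne_zero 2 (Complex.ofReal_ne_zero.2 hr.ne') hww.symm
  rw [Real.circleAverage_congr_sphere heq, ContinuousLinearMap.circleAverage_comp_comm,
    (hd.diffContOnCl_ball subset_rfl).circleAverage]
  · simp [hF]
  · exact (hd.continuousOn.mono sphere_subset_closedBall).circleIntegrable'

theorem setIntegral_circleMap_eq_circleAverage (f : ℂ → ℂ) (r : ℝ) :
    ∫ θ in Set.Ioo (-Real.pi) Real.pi, f (circleMap 0 r θ) =
      (2 * Real.pi) • Real.circleAverage f 0 r := by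
  rw [Real.circleAverage_eq_integral_add (-Real.pi),
    intervalIntegral.integral_comp_add_right (fun θ => f (circleMap 0 r θ)), smul_smul,
    mul_inv_cancel₀ Real.two_pi_pos.ne', one_smul, ← integral_Ioc_eq_integral_Ioo,
    ← intervalIntegral.integral_of_le (by linarith [Real.pi_pos])]
  congr 1 <;> ring

theorem integral_eq_integral_circleAverage {f : ℂ → ℂ} (hf : Integrable f) :
    ∫ w, f w = ∫ r in Set.Ioi (0 : ℝ), (2 * Real.pi * r) • Real.circleAverage f 0 r := by
  have hsymm : ∀ p : ℝ × ℝ, Complex.polarCoord.symm p = circleMap 0 p.1 p.2 := by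
    intro p
    rw [Complex.polarCoord_symm_apply, circleMap_zero, Complex.exp_mul_I]
    simp
  rw [← Complex.integral_comp_polarCoord_symm]
  have hInt : IntegrableOn (fun p : ℝ × ℝ => p.1 • f (Complex.polarCoord.symm p))
      (Set.Ioi 0 ×ˢ Set.Ioo (-Real.pi) Real.pi) := by
    have hf' : Integrable (f ∘ Complex.measurableEquivRealProd.symm) :=
      (Complex.volume_preserving_equiv_real_prod.symm.integrable_comp_emb
        Complex.measurableEquivRealProd.symm.measurableEmbedding).2 hf
    have h := (integrableOn_image_iff_integrableOn_abs_det_fderiv_smul volume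
      polarCoord.open_target.measurableSet
      (fun p _ => (hasFDerivAt_polarCoord_symm p).hasFDerivWithinAt) polarCoord.symm.injOn
      _).1 hf'.integrableOn
    refine h.congr_fun (fun p hp => ?_) polarCoord.open_target.measurableSet
    simp only [det_fderivPolarCoordSymm, abs_of_pos (show 0 < p.1 from hp.1)]
    rfl
  rw [polarCoord_target, Measure.volume_eq_prod, setIntegral_prod _ hInt]
  refine setIntegral_congr_fun measurableSet_Ioi fun r _ => ?_
  simp only [hsymm]
  rw [integral_smul, setIntegral_circleMap_eq_circleAverage, smul_smul, mul_comm]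

open Metric ComplexConjugate in
theorem setIntegral_unitBall_inv_sub {z : ℂ} (hz : z ∈ ball (0 : ℂ) 1) :
    ∫ w in ball (0 : ℂ) 1, (w - z)⁻¹ = -Real.pi * conj z := by
  have hz1 : ‖z‖ < 1 := by simpa using hz
  have hInt : IntegrableOn (fun w : ℂ => (w - z)⁻¹) (ball 0 1) :=
    (integrableOn_inv_norm_sub z isBounded_ball).mono'
      (measurable_id.sub_const z).inv.aestronglyMeasurable (.of_forall fun w => by simp)
  rw [← integral_indicator measurableSet_ball,
    integral_eq_integral_circleAverage ((integrable_indicator_iff measurableSet_ball).2 hInt)]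
  have hae : ∀ᵐ r ∂(volume.restrict (Set.Ioi (0 : ℝ))),
      (2 * Real.pi * r) • Real.circleAverage
        ((ball (0 : ℂ) 1).indicator fun w => (w - z)⁻¹) 0 r =
      (Set.Iio ‖z‖).indicator (fun r : ℝ => (r : ℂ) * (-(2 * Real.pi) * z⁻¹)) r := by
    filter_upwards [ae_restrict_mem measurableSet_Ioi,
      ae_restrict_of_ae (Measure.ae_ne volume ‖z‖)] with r hr hrz
    have hr : 0 < r := hr
    rcases lt_or_ge r 1 with h1 | h1
    · have hE : Set.EqOn ((ball (0 : ℂ) 1).indicator fun w => (w - z)⁻¹) (fun w => (w - z)⁻¹)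
          (sphere 0 |r|) := by
        intro w hw
        refine Set.indicator_of_mem ?_ _
        rw [mem_sphere_zero_iff_norm, abs_of_pos hr] at hw
        simpa [hw] using h1
      rw [Real.circleAverage_congr_sphere hE]
      rcases lt_or_gt_of_ne hrz with h2 | h2
      · rw [circleAverage_inv_sub_of_lt_norm hr h2, Set.indicator_of_mem (by exact h2),
          Complex.real_smul]
        push_cast
        ring
      · rw [circleAverage_inv_sub_of_norm_lt h2, smul_zero,
          Set.indicator_of_notMem (by simpa using h2.le)]
    · have hE : Set.EqOn ((ball (0 : ℂ) 1).indicator fun w => (w - z)⁻¹) (fun _ => 0)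
          (sphere 0 |r|) := by
        intro w hw
        refine Set.indicator_of_notMem ?_ _
        rw [mem_sphere_zero_iff_norm, abs_of_pos hr] at hw
        simpa [hw] using h1
      rw [Real.circleAverage_congr_sphere hE, Real.circleAverage_const, smul_zero,
        Set.indicator_of_notMem (by simpa using (hz1.trans_le h1).le)]
  rw [integral_congr_ae hae, setIntegral_indicator measurableSet_Iio, Set.Ioi_inter_Iio,
    ← integral_Ioc_eq_integral_Ioo, ← intervalIntegral.integral_of_le (norm_nonneg z),
    intervalIntegral.integral_mul_const, intervalIntegral.integral_ofReal, integral_id]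
  rcases eq_or_ne z 0 with rfl | h0
  · simp
  · have : z * conj z = (‖z‖ : ℂ) ^ 2 := Complex.mul_conj' z
    have h1 : conj z = (‖z‖ : ℂ) ^ 2 * z⁻¹ := by rw [← this]; field_simp
    rw [h1]
    push_cast
    ring

/-- if `f` is bounded, vanishes outside the closed unit disk and is
`α`-Hölder, then `Pf` is real-differentiable on the open unit disk and
`∂̄(Pf) = f` there. -/
theorem dbar_cauchyGreen_eq_self (α : ℝ) (hα : α ∈ Set.Ioo (0 : ℝ) 1)
    (f : ℂ → ℂ) (M : ℝ) (hM : ∀ z, ‖f z‖ ≤ M)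
    (hvan : ∀ z : ℂ, z ∉ Metric.closedBall (0 : ℂ) 1 → f z = 0)
    (C : ℝ) (hHol : ∀ z z' : ℂ, ‖f z - f z'‖ ≤ C * ‖z - z'‖ ^ α) :
    ∀ z ∈ Metric.ball (0 : ℂ) 1,
      DifferentiableAt ℝ (cauchyGreen f) z ∧ dbar (cauchyGreen f) z = f z := by
  intro a ha
  obtain ⟨hα0, hα1⟩ := hα
  have hfc : Continuous f := by
    refine continuous_iff_continuousAt.2 fun z => tendsto_iff_norm_sub_tendsto_zero.2 ?_
    have hc : Continuous fun w : ℂ => C * ‖w - z‖ ^ α :=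
      continuous_const.mul ((continuous_id.sub continuous_const).norm.rpow_const
        fun _ => Or.inr hα0.le)
    refine squeeze_zero (fun w => norm_nonneg _) (fun w => hHol w z) ?_
    simpa [Real.zero_rpow hα0.ne'] using hc.tendsto z
  set g : ℂ → ℂ := fun w => f w - f a with hg
  have hgm : AEStronglyMeasurable g := (hfc.sub continuous_const).aestronglyMeasurable
  have hgM : ∀ w, ‖g w‖ ≤ M + M := fun w => (norm_sub_le _ _).trans (add_le_add (hM w) (hM a))
  have hbd : Bornology.IsBounded (Metric.ball (0 : ℂ) 1) := Metric.isBounded_ball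
  set L : ℂ := ∫ w in Metric.ball (0 : ℂ) 1, g w / (w - a) ^ 2
  have hder := hasDerivAt_setIntegral_div_sub hgm hgM hα0 (by linarith) (fun w => hHol w a) hbd
  have hπ : (Real.pi : ℂ) ≠ 0 := Complex.ofReal_ne_zero.2 Real.pi_ne_zero
  have hsplit : ∀ z ∈ Metric.ball (0 : ℂ) 1, cauchyGreen f z =
      -(1 / (Real.pi : ℂ)) * (∫ w in Metric.ball (0 : ℂ) 1, g w / (w - z)) +
        f a * Complex.conjCLE z := by
    intro z hz
    have hi := integrableOn_div_sub hgm hgM z hbd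
    have hi' := integrableOn_div_sub (g := fun _ => f a) (M := ‖f a‖)
      aestronglyMeasurable_const (fun _ => le_rfl) z hbd
    have h1 : ∀ w, f w / (w - z) = g w / (w - z) + f a / (w - z) := fun w => by
      rw [← add_div, hg, sub_add_cancel]
    simp only [cauchyGreen, h1]
    rw [integral_add hi hi']
    simp only [div_eq_mul_inv (f a)]
    rw [integral_const_mul, setIntegral_unitBall_inv_sub hz, Complex.conjCLE_apply]
    field_simp
    ring
  have hfd : HasFDerivAt (𝕜 := ℝ) (cauchyGreen f)
      ((-(1 / (Real.pi : ℂ)) * L) • (1 : ℂ →L[ℝ] ℂ) +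
        f a • (Complex.conjCLE : ℂ →L[ℝ] ℂ)) a :=
    ((hder.const_mul _).complexToReal_fderiv.add
      ((Complex.conjCLE : ℂ →L[ℝ] ℂ).hasFDerivAt.const_mul (f a))).congr_of_eventuallyEq
      (Filter.eventually_of_mem (Metric.isOpen_ball.mem_nhds ha) hsplit)
  refine ⟨hfd.differentiableAt, ?_⟩
  rw [dbar, hfd.fderiv]
  simp
  linear_combination (-(1 / (Real.pi : ℂ)) * L - f a) / 2 * Complex.I_sq
end

section
/- For each p > 2 there exists a constant C = C(p) > 0 such that for every f ∈ L^p(D) the integral defining Pf converges absolutely at every z ∈ ℂ, and for all z, z' ∈ ℂ one has |Pf(z)| ≤ C ‖f‖_{L^p(D)} and |Pf(z) − Pf(z')| ≤ C ‖f‖_{L^p(D)} |z − z'|^{1−2/p}. (Part 4 of Theorem 2.1: P maps L^p boundedly into the Hölder space C^{1−2/p}.) -/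
open MeasureTheory

/-- The `L^p` norm of `f` on the unit disk. -/
noncomputable def LpNormOnDisk (f : ℂ → ℂ) (p : ℝ) : ℝ :=
  (∫ w in Metric.ball (0 : ℂ) 1, ‖f w‖ ^ p) ^ (1 / p)

/-- A radial majorant of the `q`-th power of the Cauchy kernel: `y ^ (-q)` near the origin
and `y ^ (-2 * q)` at infinity. -/
noncomputable def cauchyMajorant (q y : ℝ) : ℝ :=
  (y * max y 1)⁻¹ ^ q

lemma cauchyMajorant_nonneg (q : ℝ) {y : ℝ} (hy : 0 ≤ y) : 0 ≤ cauchyMajorant q y := by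
  unfold cauchyMajorant
  positivity

lemma integrable_cauchyMajorant_norm {q : ℝ} (h1 : 1 < q) (h2 : q < 2) :
    Integrable (fun u : ℂ => cauchyMajorant q ‖u‖) := by
  rw [integrable_fun_norm_addHaar volume, Complex.finrank_real_complex,
    ← Set.Ioc_union_Ioi_eq_Ioi zero_le_one, integrableOn_union]
  constructor
  · rw [integrableOn_Ioc_iff_integrableOn_Ioo]
    refine ((intervalIntegral.integrableOn_Ioo_rpow_iff (s := 1 - q) one_pos).2
      (by linarith)).congr_fun (fun y hy => ?_) measurableSet_Ioo
    have hy0 : 0 < y := hy.1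
    simp only [cauchyMajorant, max_eq_right hy.2.le, mul_one, smul_eq_mul, Nat.add_one_sub_one,
      pow_one]
    rw [Real.inv_rpow hy0.le, ← Real.rpow_neg hy0.le, sub_eq_add_neg, Real.rpow_add hy0,
      Real.rpow_one]
  · refine (integrableOn_Ioi_rpow_of_lt (a := 1 - 2 * q) (by linarith) one_pos).congr_fun
      (fun y hy => ?_) measurableSet_Ioi
    have hy1 : 1 < y := hy
    have hy0 : 0 < y := one_pos.trans hy1
    simp only [cauchyMajorant, max_eq_left hy1.le, smul_eq_mul, Nat.add_one_sub_one, pow_one]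
    rw [Real.inv_rpow (by positivity), Real.mul_rpow hy0.le hy0.le, sub_eq_add_neg,
      Real.rpow_add hy0, Real.rpow_one, Real.rpow_neg hy0.le, two_mul, Real.rpow_add hy0]

lemma norm_inv_rpow_le {q : ℝ} (hq : 0 ≤ q) (x : ℂ) :
    ‖x⁻¹‖ ^ q ≤ cauchyMajorant q ‖x‖ + 1 := by
  rw [norm_inv]
  rcases le_total ‖x‖ 1 with h | h
  · simp [cauchyMajorant, max_eq_right h]
  · have := Real.rpow_le_one (by positivity) (inv_le_one_of_one_le₀ h) hq
    linarith [cauchyMajorant_nonneg q (norm_nonneg x)]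

lemma norm_inv_sub_inv_rpow_le {q d : ℝ} (hq : 0 ≤ q) (hd : 0 < d) {x y : ℂ}
    (h : ‖x - y‖ = 2 * d) :
    ‖x⁻¹ - y⁻¹‖ ^ q ≤
      (2 / d) ^ q * (cauchyMajorant q (‖x‖ / d) + cauchyMajorant q (‖y‖ / d)) := by
  wlog hxy : ‖x‖ ≤ ‖y‖ generalizing x y
  · rw [norm_sub_rev, add_comm]
    exact this (by rw [norm_sub_rev, h]) (le_of_not_ge hxy)
  have hdy : d ≤ ‖y‖ := by linarith [norm_sub_le x y]
  have hy0 : 0 < ‖y‖ := hd.trans_le hdy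
  have hscale (a : ℝ) :
      2 / d * (a / d * max (a / d) 1)⁻¹ = 2 * d * (a * max a d)⁻¹ := by
    have : max (a / d) 1 = max a d / d := by
      rw [← max_div_div_right hd.le, div_self hd.ne']
    rw [this]
    field_simp
  have hx' := cauchyMajorant_nonneg q (y := ‖x‖ / d) (by positivity)
  have hy' := cauchyMajorant_nonneg q (y := ‖y‖ / d) (by positivity)
  rcases eq_or_ne x 0 with rfl | hx
  · have hy2 : ‖y‖ = 2 * d := by simpa using h
    calc ‖(0 : ℂ)⁻¹ - y⁻¹‖ ^ q = (2 / d) ^ q * cauchyMajorant q (‖y‖ / d) := by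
          rw [cauchyMajorant, ← Real.mul_rpow (by positivity) (by positivity), hscale,
            max_eq_left hdy, hy2]
          simp only [inv_zero, zero_sub, norm_neg, norm_inv, hy2]
          congr 1
          field_simp
      _ ≤ _ := by gcongr; linarith
  · have hx0 : 0 < ‖x‖ := norm_pos_iff.2 hx
    calc ‖x⁻¹ - y⁻¹‖ ^ q ≤ (2 * d * (‖x‖ * max ‖x‖ d)⁻¹) ^ q := by
          rw [inv_sub_inv hx (norm_pos_iff.1 hy0), norm_div, norm_mul, norm_sub_rev, h,
            div_eq_mul_inv]
          gcongr
          exact max_le hxy hdy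
      _ = (2 / d) ^ q * cauchyMajorant q (‖x‖ / d) := by
          rw [cauchyMajorant, ← Real.mul_rpow (by positivity) (by positivity), hscale]
      _ ≤ _ := by gcongr; linarith

lemma integrable_cauchyMajorant_sub_div {q d : ℝ} (h1 : 1 < q) (h2 : q < 2) (hd : 0 < d) (z : ℂ) :
    Integrable (fun w : ℂ => cauchyMajorant q (‖w - z‖ / d)) := by
  have := (((integrable_cauchyMajorant_norm h1 h2).comp_smul
    (inv_ne_zero hd.ne')).comp_sub_right z)
  simpa [norm_smul, abs_of_pos hd, div_eq_inv_mul] using this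

lemma integral_cauchyMajorant_sub_div (q : ℝ) {d : ℝ} (hd : 0 < d) (z : ℂ) :
    ∫ w : ℂ, cauchyMajorant q (‖w - z‖ / d) = d ^ 2 * ∫ u : ℂ, cauchyMajorant q ‖u‖ := by
  rw [integral_sub_right_eq_self (fun w : ℂ => cauchyMajorant q (‖w‖ / d)) z]
  have := Measure.integral_comp_smul volume (fun u : ℂ => cauchyMajorant q ‖u‖) d⁻¹
  simpa [norm_smul, abs_of_pos hd, div_eq_inv_mul, Complex.finrank_real_complex] using this

/-- Hölder's inequality against a kernel whose `q`-th power has an integrable majorant. -/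
lemma integrable_mul_and_norm_integral_mul_le {α : Type*} [MeasurableSpace α] {μ : Measure α}
    {p q : ℝ} (hpq : p.HolderConjugate q) {f g : α → ℂ} {B : α → ℝ}
    (hf : AEStronglyMeasurable f μ) (hfp : Integrable (fun a => ‖f a‖ ^ p) μ)
    (hg : AEStronglyMeasurable g μ) (hB : Integrable B μ) (hgB : ∀ a, ‖g a‖ ^ q ≤ B a) :
    Integrable (fun a => f a * g a) μ ∧
      ‖∫ a, f a * g a ∂μ‖ ≤ (∫ a, ‖f a‖ ^ p ∂μ) ^ (1 / p) * (∫ a, B a ∂μ) ^ (1 / q) := by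
  have hgq : Integrable (fun a => ‖g a‖ ^ q) μ := by
    refine hB.mono' (hg.norm.aemeasurable.pow_const q).aestronglyMeasurable (ae_of_all _ fun a => ?_)
    rw [Real.norm_of_nonneg (by positivity)]
    exact hgB a
  have hp0 := hpq.pos
  have hq0 := hpq.symm.pos
  have hfL : MemLp f (ENNReal.ofReal p) μ := by
    rw [← integrable_norm_rpow_iff hf (by simpa) ENNReal.ofReal_ne_top,
      ENNReal.toReal_ofReal hp0.le]
    exact hfp
  have hgL : MemLp g (ENNReal.ofReal q) μ := by
    rw [← integrable_norm_rpow_iff hg (by simpa) ENNReal.ofReal_ne_top,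
      ENNReal.toReal_ofReal hq0.le]
    exact hgq
  have : (ENNReal.ofReal p).HolderTriple (ENNReal.ofReal q) 1 := hpq.ennrealOfReal
  refine ⟨hfL.integrable_mul hgL, ?_⟩
  calc ‖∫ a, f a * g a ∂μ‖ ≤ ∫ a, ‖f a‖ * ‖g a‖ ∂μ := by
        simpa only [norm_mul] using norm_integral_le_integral_norm (μ := μ) (fun a => f a * g a)
    _ ≤ _ := integral_mul_norm_le_Lp_mul_Lq hpq hfL hgL
    _ ≤ _ := by
        have h0 : 0 ≤ ∫ a, ‖g a‖ ^ q ∂μ := integral_nonneg fun a => by positivity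
        have hm : ∫ a, ‖g a‖ ^ q ∂μ ≤ ∫ a, B a ∂μ := integral_mono hgq hB hgB
        have hf0 : 0 ≤ ∫ a, ‖f a‖ ^ p ∂μ := integral_nonneg fun a => by positivity
        gcongr

lemma LpNormOnDisk_nonneg (f : ℂ → ℂ) (p : ℝ) : 0 ≤ LpNormOnDisk f p :=
  Real.rpow_nonneg (integral_nonneg fun a => by positivity) _

lemma norm_neg_one_div_pi_mul_le (a : ℂ) : ‖-(1 / (Real.pi : ℂ)) * a‖ ≤ ‖a‖ := by
  rw [norm_mul, norm_neg, norm_div, norm_one, Complex.norm_real,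
    Real.norm_of_nonneg Real.pi_pos.le]
  exact mul_le_of_le_one_left (norm_nonneg a)
    ((div_le_one Real.pi_pos).2 (by linarith [Real.pi_gt_three]))

/-- for `p > 2` the Cauchy–Green operator maps `L^p(D)` boundedly
into the Hölder space `C^{1-2/p}`. -/
theorem cauchyGreen_lp_to_holder (p : ℝ) (hp : 2 < p) :
    ∃ C > 0, ∀ f : ℂ → ℂ,
      AEStronglyMeasurable f (volume.restrict (Metric.ball (0 : ℂ) 1)) →
      IntegrableOn (fun w => ‖f w‖ ^ p) (Metric.ball (0 : ℂ) 1) →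
      (∀ z : ℂ, IntegrableOn (fun w => f w / (w - z)) (Metric.ball (0 : ℂ) 1)) ∧
      (∀ z : ℂ, ‖cauchyGreen f z‖ ≤ C * LpNormOnDisk f p) ∧
      (∀ z z' : ℂ, ‖cauchyGreen f z - cauchyGreen f z'‖ ≤
        C * LpNormOnDisk f p * ‖z - z'‖ ^ (1 - 2 / p)) := by
  set D : Set ℂ := Metric.ball (0 : ℂ) 1
  obtain ⟨q, hq⟩ : ∃ q, q = p / (p - 1) := ⟨_, rfl⟩
  have hpq : p.HolderConjugate q := by
    rw [hq]
    exact Real.HolderConjugate.conjExponent (by linarith)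
  set K : ℝ := ∫ u : ℂ, cauchyMajorant q ‖u‖ with hK
  have h1 : 1 < q := hpq.symm.lt
  have h2 : q < 2 := by
    rw [hq, div_lt_iff₀ (by linarith)]
    linarith
  have hq0 : 0 < q := by linarith
  have hexp : (2 - q) * (1 / q) = 1 - 2 / p := by
    have := hpq.inv_add_inv_eq_one
    have hp' : p⁻¹ = 1 - q⁻¹ := by linarith
    rw [div_eq_mul_inv 2 p, hp']
    field_simp
    ring
  have hK0 : 0 ≤ K := integral_nonneg fun u => cauchyMajorant_nonneg _ (norm_nonneg u)
  have hV : 0 < volume.real D :=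
    ENNReal.toReal_pos (Metric.measure_ball_pos volume 0 one_pos).ne' measure_ball_lt_top.ne
  have hMi (z : ℂ) {d : ℝ} (hd : 0 < d) := integrable_cauchyMajorant_sub_div h1 h2 hd z
  have hkm (z : ℂ) : AEStronglyMeasurable (fun w : ℂ => (w - z)⁻¹) (volume.restrict D) :=
    (measurable_id.sub_const z).inv.aestronglyMeasurable
  set A : ℝ := (K + volume.real D) ^ (1 / q)
  set B : ℝ := (2 ^ (q + 1) * K) ^ (1 / q)
  have hA : 0 < A := by positivity
  have hB : 0 ≤ B := by positivity
  refine ⟨A + B, by positivity, fun f hf hfp => ?_⟩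
  have hN := LpNormOnDisk_nonneg f p
  have hsup (z : ℂ) : IntegrableOn (fun w => f w / (w - z)) D ∧
      ‖∫ w in D, f w / (w - z)‖ ≤ LpNormOnDisk f p * A := by
    have hMz : Integrable (fun w : ℂ => cauchyMajorant q ‖w - z‖) := by
      simpa using hMi z one_pos
    have h1D : IntegrableOn (fun _ : ℂ => (1 : ℝ)) D :=
      integrableOn_const measure_ball_lt_top.ne
    obtain ⟨hi, hle⟩ := integrable_mul_and_norm_integral_mul_le hpq hf hfp (hkm z)
      (hMz.integrableOn.add h1D) fun w => norm_inv_rpow_le hq0.le (w - z)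
    simp only [div_eq_mul_inv]
    refine ⟨hi, hle.trans ?_⟩
    refine mul_le_mul_of_nonneg_left ?_ hN
    have h0 (w : ℂ) : 0 ≤ cauchyMajorant q ‖w - z‖ := cauchyMajorant_nonneg q (norm_nonneg _)
    have hint : ∫ w in D, (cauchyMajorant q ‖w - z‖ + 1) ≤ K + volume.real D := by
      rw [integral_add hMz.integrableOn h1D]
      refine add_le_add ?_ (by simp)
      refine (setIntegral_le_integral hMz (ae_of_all _ h0)).trans_eq ?_
      rw [hK]
      exact integral_sub_right_eq_self (fun w : ℂ => cauchyMajorant q ‖w‖) z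
    exact Real.rpow_le_rpow (integral_nonneg fun w => add_nonneg (h0 w) zero_le_one) hint
      (by positivity)
  refine ⟨fun z => (hsup z).1, fun z => ?_, fun z z' => ?_⟩
  · refine (norm_neg_one_div_pi_mul_le _).trans ((hsup z).2.trans ?_)
    nlinarith
  rcases eq_or_ne z z' with rfl | hz
  · simp only [sub_self, norm_zero]
    positivity
  obtain ⟨d, hd⟩ : ∃ d, d = ‖z - z'‖ / 2 := ⟨_, rfl⟩
  have hd0 : 0 < d := by
    rw [hd]
    exact half_pos (norm_pos_iff.2 (sub_ne_zero.2 hz))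
  have hsum := (hMi z hd0).add (hMi z' hd0)
  obtain ⟨-, hle⟩ := integrable_mul_and_norm_integral_mul_le hpq hf hfp ((hkm z).sub (hkm z'))
    (hsum.const_mul ((2 / d) ^ q)).integrableOn fun w =>
      norm_inv_sub_inv_rpow_le hq0.le hd0 (x := w - z) (y := w - z')
        (by rw [sub_sub_sub_cancel_left, norm_sub_rev, hd]; ring)
  have h0 (w : ℂ) :
      0 ≤ (2 / d) ^ q * (cauchyMajorant q (‖w - z‖ / d) + cauchyMajorant q (‖w - z'‖ / d)) :=
    mul_nonneg (by positivity) (add_nonneg (cauchyMajorant_nonneg q (by positivity))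
      (cauchyMajorant_nonneg q (by positivity)))
  have hint : ∫ w in D, (2 / d) ^ q *
      (cauchyMajorant q (‖w - z‖ / d) + cauchyMajorant q (‖w - z'‖ / d)) ≤
      2 ^ (q + 1) * K * d ^ (2 - q) := by
    refine (setIntegral_le_integral (hsum.const_mul _) (ae_of_all _ h0)).trans_eq ?_
    simp only [Pi.add_apply]
    rw [integral_const_mul, integral_add (hMi z hd0) (hMi z' hd0),
      integral_cauchyMajorant_sub_div q hd0, integral_cauchyMajorant_sub_div q hd0, ← hK,
      Real.div_rpow zero_le_two hd0.le, Real.rpow_add_one two_ne_zero, Real.rpow_sub hd0,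
      Real.rpow_two]
    ring
  have hdiff : cauchyGreen f z - cauchyGreen f z' =
      -(1 / (Real.pi : ℂ)) * ∫ w in D, f w * ((w - z)⁻¹ - (w - z')⁻¹) := by
    simp only [cauchyGreen, mul_sub, ← div_eq_mul_inv]
    rw [integral_sub (hsup z).1 (hsup z').1, mul_sub]
  rw [hdiff]
  refine (norm_neg_one_div_pi_mul_le _).trans (hle.trans ?_)
  calc LpNormOnDisk f p * _ ≤ LpNormOnDisk f p * (2 ^ (q + 1) * K * d ^ (2 - q)) ^ (1 / q) :=
        mul_le_mul_of_nonneg_left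
          (Real.rpow_le_rpow (integral_nonneg h0) hint (by positivity)) hN
    _ = LpNormOnDisk f p * (B * d ^ (1 - 2 / p)) := by
        rw [Real.mul_rpow (by positivity) (by positivity), ← Real.rpow_mul hd0.le, hexp]
    _ ≤ LpNormOnDisk f p * ((A + B) * ‖z - z'‖ ^ (1 - 2 / p)) := by
        have he : 0 ≤ 1 - 2 / p := by
          rw [← hexp]
          exact mul_nonneg (by linarith) (by positivity)
        have hdz : d ≤ ‖z - z'‖ := by linarith [norm_nonneg (z - z')]
        gcongr
        linarith
    _ = _ := by ring
end

section
/- For each α ∈ (0,1) there exists a constant C = C(α) > 0 such that for every f : ℂ → ℂ which vanishes outside the closed unit disk and is bounded and α-Hölder, the function Pf is continuously differentiable on the open unit disk D, and both derivatives ∂(Pf) and ∂̄(Pf) are bounded by C‖f‖_{C^α} and are α-Hölder on D with Hölder constant at most C‖f‖_{C^α}. (Part 5 of Theorem 2.1: P : C^α → C^{1,α} and T = ∂P : C^α → C^α are bounded.) -/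
open MeasureTheory

/-- The operator `∂g = ½(∂g/∂x − i ∂g/∂y)`. -/
noncomputable def dop (g : ℂ → ℂ) (z : ℂ) : ℂ :=
  (1 / 2 : ℂ) * (fderiv ℝ g z 1 - Complex.I * fderiv ℝ g z Complex.I)

/-! ### Radial integrals in the plane -/

lemma integrable_norm_rpow_div_sq_mul {β : ℝ} (h0 : 0 < β) (h2 : β < 2) :
    Integrable (fun ζ : ℂ => ‖ζ‖ ^ β / (‖ζ‖ ^ 2 * (‖ζ‖ ^ 2 + 1))) := by
  have key : IntegrableOn (fun r : ℝ => r * (r ^ β / (r ^ 2 * (r ^ 2 + 1)))) (Set.Ioi 0) := by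
    have hmeas : Measurable (fun r : ℝ => r * (r ^ β / (r ^ 2 * (r ^ 2 + 1)))) := by fun_prop
    rw [← Set.Ioc_union_Ioi_eq_Ioi (zero_le_one' ℝ)]
    refine IntegrableOn.union ?_ ?_
    · have h : IntegrableOn (fun r : ℝ => r ^ (β - 1)) (Set.Ioc 0 1) :=
        (intervalIntegrable_iff_integrableOn_Ioc_of_le zero_le_one).1
          (intervalIntegral.intervalIntegrable_rpow' (by linarith))
      refine Integrable.mono' h hmeas.aestronglyMeasurable ?_
      filter_upwards [ae_restrict_mem measurableSet_Ioc] with r hr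
      have hr0 : 0 < r := hr.1
      rw [Real.norm_of_nonneg (by positivity), Real.rpow_sub_one hr0.ne']
      have : r * (r ^ β / (r ^ 2 * (r ^ 2 + 1))) = r ^ β / r / (r ^ 2 + 1) := by
        field_simp
      rw [this]
      exact div_le_self (by positivity) (by nlinarith)
    · have h : IntegrableOn (fun r : ℝ => r ^ (β - 3)) (Set.Ioi 1) :=
        integrableOn_Ioi_rpow_of_lt (by linarith) one_pos
      refine Integrable.mono' h hmeas.aestronglyMeasurable ?_
      filter_upwards [ae_restrict_mem measurableSet_Ioi] with r hr
      have hr1 : 1 < r := hr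
      have hr0 : 0 < r := by linarith
      rw [Real.norm_of_nonneg (by positivity), Real.rpow_sub hr0]
      have h3 : r ^ (3 : ℝ) = r ^ 3 := by norm_cast
      have : r * (r ^ β / (r ^ 2 * (r ^ 2 + 1))) = r ^ β / (r * (r ^ 2 + 1)) := by
        field_simp
      rw [this, h3]
      gcongr
      nlinarith
  have := (integrable_fun_norm_addHaar (E := ℂ) volume
    (f := fun r : ℝ => r ^ β / (r ^ 2 * (r ^ 2 + 1)))).2
  refine this ?_
  simpa [Complex.finrank_real_complex] using key

lemma integrable_norm_rpow_div_add_one_cube {α : ℝ} (h0 : 0 ≤ α) (h1 : α < 1) :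
    Integrable (fun ζ : ℂ => ‖ζ‖ ^ α / (‖ζ‖ + 1) ^ 3) := by
  have h : Integrable (fun ζ : ℂ => (1 + ‖ζ‖) ^ (-(3 - α))) :=
    integrable_one_add_norm (by rw [Complex.finrank_real_complex]; push_cast; linarith)
  refine h.mono' (by fun_prop : Measurable _).aestronglyMeasurable (.of_forall fun ζ => ?_)
  rw [Real.norm_of_nonneg (by positivity), neg_sub, Real.rpow_sub (by positivity), add_comm 1]
  have h3 : (‖ζ‖ + 1) ^ (3 : ℝ) = (‖ζ‖ + 1) ^ 3 := by norm_cast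
  rw [h3]
  gcongr
  linarith

lemma integrable_inv_norm_sq_add_one_sq :
    Integrable (fun ζ : ℂ => 1 / (‖ζ‖ ^ 2 + 1) ^ 2) := by
  have h : Integrable (fun ζ : ℂ => (1 + ‖ζ‖ ^ 2) ^ (-(4 : ℝ) / 2)) :=
    integrable_rpow_neg_one_add_norm_sq
      (by rw [Complex.finrank_real_complex]; norm_num)
  refine h.congr (.of_forall fun ζ => ?_)
  dsimp only
  rw [show (-(4 : ℝ) / 2) = -2 by norm_num, Real.rpow_neg (by positivity), one_div, add_comm]
  norm_cast

lemma integral_comp_inv_smul_complex {F : Type*} [NormedAddCommGroup F] [NormedSpace ℝ F]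
    (g : ℂ → F) {ε : ℝ} (hε : 0 < ε) : ∫ ζ, g (ε⁻¹ • ζ) = ε ^ 2 • ∫ ζ, g ζ := by
  rw [Measure.integral_comp_inv_smul_of_nonneg _ _ hε.le, Complex.finrank_real_complex]

lemma norm_rpow_mul_sq_div_eq {β ε : ℝ} (hε : 0 < ε) (ζ : ℂ) :
    ‖ζ‖ ^ β * (ε ^ 2 / (‖ζ‖ ^ 2 * (‖ζ‖ ^ 2 + ε ^ 2))) =
      ε ^ β * ε⁻¹ ^ 2 * (‖ε⁻¹ • ζ‖ ^ β / (‖ε⁻¹ • ζ‖ ^ 2 * (‖ε⁻¹ • ζ‖ ^ 2 + 1))) := by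
  rw [norm_smul, Real.norm_of_nonneg (by positivity), Real.mul_rpow (by positivity) (by positivity),
    Real.inv_rpow hε.le]
  have : 0 < ε ^ β := by positivity
  rcases eq_or_ne ζ 0 with rfl | hζ
  · simp
  have : 0 < ‖ζ‖ := norm_pos_iff.2 hζ
  field_simp

lemma integrable_norm_rpow_mul_sq_div {β ε : ℝ} (h0 : 0 < β) (h2 : β < 2) (hε : 0 < ε) :
    Integrable (fun ζ : ℂ => ‖ζ‖ ^ β * (ε ^ 2 / (‖ζ‖ ^ 2 * (‖ζ‖ ^ 2 + ε ^ 2)))) := by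
  simp only [norm_rpow_mul_sq_div_eq hε]
  exact ((integrable_norm_rpow_div_sq_mul h0 h2).comp_smul (inv_ne_zero hε.ne')).const_mul _

lemma integral_norm_rpow_mul_sq_div {β ε : ℝ} (hε : 0 < ε) :
    ∫ ζ : ℂ, ‖ζ‖ ^ β * (ε ^ 2 / (‖ζ‖ ^ 2 * (‖ζ‖ ^ 2 + ε ^ 2))) =
      ε ^ β * ∫ ζ : ℂ, ‖ζ‖ ^ β / (‖ζ‖ ^ 2 * (‖ζ‖ ^ 2 + 1)) := by
  simp only [norm_rpow_mul_sq_div_eq hε]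
  rw [integral_const_mul, integral_comp_inv_smul_complex
    (fun ζ => ‖ζ‖ ^ β / (‖ζ‖ ^ 2 * (‖ζ‖ ^ 2 + 1))) hε, smul_eq_mul]
  field_simp

lemma norm_rpow_mul_div_cube_eq {α h : ℝ} (hh : 0 < h) (ζ : ℂ) :
    ‖ζ‖ ^ α * (h / (‖ζ‖ + h) ^ 3) =
      h ^ α * h⁻¹ ^ 2 * (‖h⁻¹ • ζ‖ ^ α / (‖h⁻¹ • ζ‖ + 1) ^ 3) := by
  rw [norm_smul, Real.norm_of_nonneg (by positivity), Real.mul_rpow (by positivity) (by positivity),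
    Real.inv_rpow hh.le]
  have : 0 < h ^ α := by positivity
  field_simp

lemma integrable_norm_rpow_mul_div_cube {α h : ℝ} (h0 : 0 ≤ α) (h1 : α < 1) (hh : 0 < h) :
    Integrable (fun ζ : ℂ => ‖ζ‖ ^ α * (h / (‖ζ‖ + h) ^ 3)) := by
  simp only [norm_rpow_mul_div_cube_eq hh]
  exact ((integrable_norm_rpow_div_add_one_cube h0 h1).comp_smul (inv_ne_zero hh.ne')).const_mul _

lemma integral_norm_rpow_mul_div_cube {α h : ℝ} (hh : 0 < h) :
    ∫ ζ : ℂ, ‖ζ‖ ^ α * (h / (‖ζ‖ + h) ^ 3) = h ^ α * ∫ ζ : ℂ, ‖ζ‖ ^ α / (‖ζ‖ + 1) ^ 3 := by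
  simp only [norm_rpow_mul_div_cube_eq hh]
  rw [integral_const_mul, integral_comp_inv_smul_complex
    (fun ζ => ‖ζ‖ ^ α / (‖ζ‖ + 1) ^ 3) hh, smul_eq_mul]
  field_simp

lemma sq_div_sq_add_sq_sq_eq {ε : ℝ} (hε : 0 < ε) (ζ : ℂ) :
    ε ^ 2 / (‖ζ‖ ^ 2 + ε ^ 2) ^ 2 = ε⁻¹ ^ 2 * (1 / (‖ε⁻¹ • ζ‖ ^ 2 + 1) ^ 2) := by
  rw [norm_smul, Real.norm_of_nonneg (by positivity)]
  field_simp

lemma integrable_sq_div_sq_add_sq_sq {ε : ℝ} (hε : 0 < ε) :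
    Integrable (fun ζ : ℂ => ε ^ 2 / (‖ζ‖ ^ 2 + ε ^ 2) ^ 2) := by
  simp only [sq_div_sq_add_sq_sq_eq hε]
  exact (integrable_inv_norm_sq_add_one_sq.comp_smul (inv_ne_zero hε.ne')).const_mul _

lemma integral_sq_div_sq_add_sq_sq {ε : ℝ} (hε : 0 < ε) :
    ∫ ζ : ℂ, ε ^ 2 / (‖ζ‖ ^ 2 + ε ^ 2) ^ 2 = ∫ ζ : ℂ, 1 / (‖ζ‖ ^ 2 + 1) ^ 2 := by
  simp only [sq_div_sq_add_sq_sq_eq hε]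
  rw [integral_const_mul, integral_comp_inv_smul_complex
    (fun ζ => 1 / (‖ζ‖ ^ 2 + 1) ^ 2) hε, smul_eq_mul]
  field_simp

/-! ### The regularised Cauchy kernel -/

/-- The regularised Cauchy kernel `ζ̄ / (|ζ|² + ε²)`; for `ε = 0` it is `ζ⁻¹`. -/
noncomputable def regCauchyKernel (ε : ℝ) (ζ : ℂ) : ℂ :=
  ((‖ζ‖ ^ 2 + ε ^ 2)⁻¹ : ℝ) • (starRingEnd ℂ) ζ

/-- The real derivative of the regularised Cauchy kernel. -/
noncomputable def regCauchyKernelDeriv (ε : ℝ) (ζ : ℂ) : ℂ →L[ℝ] ℂ :=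
  (ε ^ 2 / (‖ζ‖ ^ 2 + ε ^ 2) ^ 2) • (Complex.conjCLE : ℂ →L[ℝ] ℂ) -
    (regCauchyKernel ε ζ) ^ 2 • ContinuousLinearMap.id ℝ ℂ

lemma regCauchyKernel_zero (ζ : ℂ) : regCauchyKernel 0 ζ = ζ⁻¹ := by
  rw [regCauchyKernel, Complex.inv_def, Complex.normSq_eq_norm_sq, Complex.real_smul, mul_comm]
  simp

lemma continuous_regCauchyKernel {ε : ℝ} (hε : 0 < ε) : Continuous (regCauchyKernel ε) := by
  have h : ∀ ζ : ℂ, ‖ζ‖ ^ 2 + ε ^ 2 ≠ 0 := fun ζ => by positivity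
  unfold regCauchyKernel
  have := Complex.continuous_conj
  fun_prop (disch := assumption)

lemma measurable_regCauchyKernel (ε : ℝ) : Measurable (regCauchyKernel ε) := by
  have := Complex.continuous_conj.measurable
  unfold regCauchyKernel
  fun_prop

lemma continuous_regCauchyKernelDeriv {ε : ℝ} (hε : 0 < ε) :
    Continuous (regCauchyKernelDeriv ε) := by
  have h : ∀ ζ : ℂ, (‖ζ‖ ^ 2 + ε ^ 2) ^ 2 ≠ 0 := fun ζ => by positivity
  have := continuous_regCauchyKernel hε
  unfold regCauchyKernelDeriv
  fun_prop (disch := assumption)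

lemma stronglyMeasurable_regCauchyKernelDeriv (ε : ℝ) :
    StronglyMeasurable (regCauchyKernelDeriv ε) := by
  have h1 : Measurable fun ζ : ℂ => ε ^ 2 / (‖ζ‖ ^ 2 + ε ^ 2) ^ 2 := by fun_prop
  have h2 := (measurable_regCauchyKernel ε).pow_const 2
  exact (h1.stronglyMeasurable.smul_const _).sub (h2.stronglyMeasurable.smul_const _)

lemma hasFDerivAt_regCauchyKernel {ε : ℝ} (hε : 0 < ε) (ζ : ℂ) :
    HasFDerivAt (regCauchyKernel ε) (regCauchyKernelDeriv ε ζ) ζ := by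
  have hs : ‖ζ‖ ^ 2 + ε ^ 2 ≠ 0 := by positivity
  have h1 : HasFDerivAt (fun ζ : ℂ => ‖ζ‖ ^ 2 + ε ^ 2) (2 • innerSL ℝ ζ) ζ :=
    (hasStrictFDerivAt_norm_sq ζ).hasFDerivAt.add_const _
  have h2 := (hasDerivAt_inv hs).comp_hasFDerivAt ζ h1
  have h3 : HasFDerivAt (fun ζ : ℂ => (starRingEnd ℂ) ζ) (Complex.conjCLE : ℂ →L[ℝ] ℂ) ζ :=
    (Complex.conjCLE : ℂ →L[ℝ] ℂ).hasFDerivAt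
  refine (h2.smul h3).congr_fderiv ?_
  refine ContinuousLinearMap.ext fun e => ?_
  have hn : ‖ζ‖ ^ 2 = ζ.re * ζ.re + ζ.im * ζ.im := by
    rw [← Complex.normSq_apply, Complex.normSq_eq_norm_sq]
  have hc := inv_mul_cancel₀ hs
  change (‖ζ‖ ^ 2 + ε ^ 2)⁻¹ • (starRingEnd ℂ) e +
      (-((‖ζ‖ ^ 2 + ε ^ 2) ^ 2)⁻¹ • 2 • inner ℝ ζ e) • (starRingEnd ℂ) ζ =
    (ε ^ 2 / (‖ζ‖ ^ 2 + ε ^ 2) ^ 2) • (starRingEnd ℂ) e -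
      ((‖ζ‖ ^ 2 + ε ^ 2)⁻¹ • (starRingEnd ℂ) ζ) ^ 2 * e
  rw [div_eq_mul_inv, ← inv_pow]
  generalize (‖ζ‖ ^ 2 + ε ^ 2)⁻¹ = c at hc
  rw [hn] at hc
  apply Complex.ext
  · simp [Complex.inner, pow_two]
    linear_combination -(c * e.re) * hc
  · simp [Complex.inner, pow_two]
    linear_combination (c * e.im) * hc

lemma norm_regCauchyKernel (ε : ℝ) (ζ : ℂ) :
    ‖regCauchyKernel ε ζ‖ = ‖ζ‖ / (‖ζ‖ ^ 2 + ε ^ 2) := by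
  rw [regCauchyKernel, norm_smul, RCLike.norm_conj, Real.norm_of_nonneg (by positivity)]
  ring

lemma norm_smul_conjCLE_sub_smul_id_le (b : ℝ) (a : ℂ) :
    ‖b • (Complex.conjCLE : ℂ →L[ℝ] ℂ) - a • ContinuousLinearMap.id ℝ ℂ‖ ≤ |b| + ‖a‖ := by
  refine (norm_sub_le _ _).trans ?_
  rw [norm_smul, norm_smul, Complex.conjCLE_norm, ContinuousLinearMap.norm_id, mul_one, mul_one,
    Real.norm_eq_abs]

lemma regCauchyKernelDeriv_sub (ε δ : ℝ) (ζ ξ : ℂ) :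
    regCauchyKernelDeriv ε ζ - regCauchyKernelDeriv δ ξ =
      (ε ^ 2 / (‖ζ‖ ^ 2 + ε ^ 2) ^ 2 - δ ^ 2 / (‖ξ‖ ^ 2 + δ ^ 2) ^ 2) •
        (Complex.conjCLE : ℂ →L[ℝ] ℂ) -
      (regCauchyKernel ε ζ ^ 2 - regCauchyKernel δ ξ ^ 2) • ContinuousLinearMap.id ℝ ℂ := by
  refine ContinuousLinearMap.ext fun e => ?_
  simp [regCauchyKernelDeriv]
  ring

lemma norm_regCauchyKernelDeriv_le {ε : ℝ} (hε : 0 < ε) (ζ : ℂ) :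
    ‖regCauchyKernelDeriv ε ζ‖ ≤ 1 / ε ^ 2 := by
  refine (norm_smul_conjCLE_sub_smul_id_le _ _).trans ?_
  rw [abs_of_nonneg (by positivity), norm_pow, norm_regCauchyKernel]
  have : ε ^ 2 / (‖ζ‖ ^ 2 + ε ^ 2) ^ 2 + (‖ζ‖ / (‖ζ‖ ^ 2 + ε ^ 2)) ^ 2 =
      1 / (‖ζ‖ ^ 2 + ε ^ 2) := by
    field_simp
    ring
  rw [this]
  gcongr
  nlinarith [sq_nonneg ‖ζ‖]

lemma regCauchyKernel_sub {ε δ : ℝ} {ζ : ℂ} (h1 : ‖ζ‖ ^ 2 + ε ^ 2 ≠ 0)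
    (h2 : ‖ζ‖ ^ 2 + δ ^ 2 ≠ 0) :
    ‖regCauchyKernel ε ζ - regCauchyKernel δ ζ‖ =
      ‖ζ‖ * (|ε ^ 2 - δ ^ 2| / ((‖ζ‖ ^ 2 + ε ^ 2) * (‖ζ‖ ^ 2 + δ ^ 2))) := by
  rw [regCauchyKernel, regCauchyKernel, ← sub_smul, norm_smul, RCLike.norm_conj, inv_sub_inv h1 h2,
    norm_div, Real.norm_eq_abs, Real.norm_of_nonneg (by positivity), abs_sub_comm (ε ^ 2), mul_comm]
  congr 3
  ring

lemma norm_regCauchyKernel_sq_sub_le {ε δ : ℝ} {ζ : ℂ} (h1 : ‖ζ‖ ^ 2 + ε ^ 2 ≠ 0)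
    (h2 : ‖ζ‖ ^ 2 + δ ^ 2 ≠ 0) :
    ‖regCauchyKernel ε ζ ^ 2 - regCauchyKernel δ ζ ^ 2‖ ≤
      2 * (|ε ^ 2 - δ ^ 2| / ((‖ζ‖ ^ 2 + ε ^ 2) * (‖ζ‖ ^ 2 + δ ^ 2))) := by
  rw [sq_sub_sq, norm_mul, regCauchyKernel_sub h1 h2, ← mul_assoc]
  gcongr
  have hb : ∀ ε : ℝ, ‖ζ‖ ^ 2 + ε ^ 2 ≠ 0 → ‖regCauchyKernel ε ζ‖ * ‖ζ‖ ≤ 1 := fun ε h => by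
    rw [norm_regCauchyKernel, div_mul_eq_mul_div]
    exact div_le_one_of_le₀ (by nlinarith [sq_nonneg ε]) (by positivity)
  calc _ ≤ (‖regCauchyKernel ε ζ‖ + ‖regCauchyKernel δ ζ‖) * ‖ζ‖ := by gcongr; exact norm_add_le _ _
    _ ≤ 2 := by rw [add_mul]; linarith [hb ε h1, hb δ h2]

lemma norm_regCauchyKernelDeriv_sub_zero_le {ε : ℝ} (hε : 0 < ε) (ζ : ℂ) (hζ : ζ ≠ 0) :
    ‖regCauchyKernelDeriv ε ζ - regCauchyKernelDeriv 0 ζ‖ ≤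
      3 * (ε ^ 2 / (‖ζ‖ ^ 2 * (‖ζ‖ ^ 2 + ε ^ 2))) := by
  have hn : 0 < ‖ζ‖ := norm_pos_iff.2 hζ
  rw [regCauchyKernelDeriv_sub]
  refine (norm_smul_conjCLE_sub_smul_id_le _ _).trans ?_
  have h1 := norm_regCauchyKernel_sq_sub_le (ε := ε) (δ := 0) (ζ := ζ) (by positivity)
    (by positivity)
  have h2 : |ε ^ 2 / (‖ζ‖ ^ 2 + ε ^ 2) ^ 2 - 0 ^ 2 / (‖ζ‖ ^ 2 + 0 ^ 2) ^ 2| ≤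
      ε ^ 2 / (‖ζ‖ ^ 2 * (‖ζ‖ ^ 2 + ε ^ 2)) := by
    rw [zero_pow two_ne_zero, zero_div, sub_zero, abs_of_nonneg (by positivity)]
    gcongr
    nlinarith [sq_nonneg ε, sq_nonneg ‖ζ‖]
  rw [zero_pow two_ne_zero, sub_zero, add_zero, abs_of_nonneg (by positivity),
    mul_comm (‖ζ‖ ^ 2 + ε ^ 2)] at h1
  simp only [zero_pow two_ne_zero] at h2 ⊢
  linarith

lemma div_sq_add_sq_le {x r h : ℝ} (hh : 0 < h) (hr : 0 ≤ r) (hx : x ≤ r + h) :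
    x / (r ^ 2 + h ^ 2) ≤ 2 / (r + h) := by
  rw [div_le_div_iff₀ (by positivity) (by positivity)]
  nlinarith [sq_nonneg (r - h)]

lemma abs_inv_sub_inv_mul_le {x r q h : ℝ} (hh : 0 < h) (hr : 0 ≤ r) (hq : 0 ≤ q)
    (hrq : |r - q| ≤ h) (hx0 : 0 ≤ x) (hx : x ≤ q + h) :
    |(r ^ 2 + h ^ 2)⁻¹ - (q ^ 2 + h ^ 2)⁻¹| * x ≤ 12 * (h / (r + h) ^ 2) := by
  have hs : 1 / (r ^ 2 + h ^ 2) ≤ 2 / (r + h) ^ 2 := by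
    rw [div_le_div_iff₀ (by positivity) (by positivity)]
    nlinarith [sq_nonneg (r - h)]
  have ht := div_sq_add_sq_le hh hq hx
  have hst : |q ^ 2 + h ^ 2 - (r ^ 2 + h ^ 2)| ≤ h * (3 * (q + h)) := by
    rw [show q ^ 2 + h ^ 2 - (r ^ 2 + h ^ 2) = (q - r) * (q + r) by ring, abs_mul,
      abs_of_nonneg (by positivity : 0 ≤ q + r), abs_sub_comm]
    gcongr
    linarith [le_of_abs_le hrq]
  calc _ = |q ^ 2 + h ^ 2 - (r ^ 2 + h ^ 2)| * (1 / (r ^ 2 + h ^ 2)) * (x / (q ^ 2 + h ^ 2)) := by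
        rw [inv_sub_inv (by positivity) (by positivity), abs_div,
          abs_of_pos (by positivity : 0 < (r ^ 2 + h ^ 2) * (q ^ 2 + h ^ 2))]
        field_simp
    _ ≤ h * (3 * (q + h)) * (2 / (r + h) ^ 2) * (2 / (q + h)) := by gcongr
    _ = 12 * (h / (r + h) ^ 2) := by
        have : q + h ≠ 0 := by positivity
        field_simp
        ring

lemma two_div_add_two_div_le {r q h : ℝ} (hh : 0 < h) (hr : 0 ≤ r) (hq : 0 ≤ q)
    (hrq : |r - q| ≤ h) : 2 / (r + h) + 2 / (q + h) ≤ 6 / (r + h) := by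
  have : 2 / (q + h) ≤ 4 / (r + h) := by
    rw [div_le_div_iff₀ (by positivity) (by positivity)]
    linarith [le_of_abs_le hrq]
  calc _ ≤ 2 / (r + h) + 4 / (r + h) := by gcongr
    _ = _ := by ring

lemma norm_regCauchyKernelDeriv_sub_le_of_norm_sub_le {h : ℝ} (hh : 0 < h) {ζ ξ : ℂ}
    (hd : ‖ζ - ξ‖ ≤ h) :
    ‖regCauchyKernelDeriv h ζ - regCauchyKernelDeriv h ξ‖ ≤ 156 * (h / (‖ζ‖ + h) ^ 3) := by
  have hrq : |‖ζ‖ - ‖ξ‖| ≤ h := (abs_norm_sub_norm_le ζ ξ).trans hd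
  have hr := norm_nonneg ζ
  have hq := norm_nonneg ξ
  have hsum := two_div_add_two_div_le hh hr hq hrq
  rw [regCauchyKernelDeriv_sub]
  refine (norm_smul_conjCLE_sub_smul_id_le _ _).trans ?_
  have hK : ‖regCauchyKernel h ζ - regCauchyKernel h ξ‖ ≤ 14 * (h / (‖ζ‖ + h) ^ 2) := by
    have hs : (‖ζ‖ ^ 2 + h ^ 2)⁻¹ * ‖ζ - ξ‖ ≤ 2 * (h / (‖ζ‖ + h) ^ 2) := by
      rw [inv_mul_eq_div, ← mul_div_assoc, div_le_div_iff₀ (by positivity) (by positivity)]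
      have : (‖ζ‖ + h) ^ 2 ≤ 2 * (‖ζ‖ ^ 2 + h ^ 2) := by nlinarith [sq_nonneg (‖ζ‖ - h)]
      calc _ ≤ h * (2 * (‖ζ‖ ^ 2 + h ^ 2)) := by gcongr
        _ = _ := by ring
    have hsplit : regCauchyKernel h ζ - regCauchyKernel h ξ =
        (‖ζ‖ ^ 2 + h ^ 2)⁻¹ • (starRingEnd ℂ) (ζ - ξ) +
          ((‖ζ‖ ^ 2 + h ^ 2)⁻¹ - (‖ξ‖ ^ 2 + h ^ 2)⁻¹) • (starRingEnd ℂ) ξ := by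
      rw [regCauchyKernel, regCauchyKernel, map_sub, smul_sub, sub_smul]
      abel
    rw [hsplit]
    refine (norm_add_le _ _).trans ?_
    rw [norm_smul, norm_smul, RCLike.norm_conj, RCLike.norm_conj, Real.norm_eq_abs,
      Real.norm_eq_abs, abs_of_pos (by positivity)]
    linarith [abs_inv_sub_inv_mul_le hh hr hq hrq hq (by linarith)]
  have ha : ‖regCauchyKernel h ζ ^ 2 - regCauchyKernel h ξ ^ 2‖ ≤
      6 / (‖ζ‖ + h) * (14 * (h / (‖ζ‖ + h) ^ 2)) := by
    rw [sq_sub_sq, norm_mul]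
    gcongr
    refine (norm_add_le _ _).trans (le_trans ?_ hsum)
    rw [norm_regCauchyKernel, norm_regCauchyKernel]
    exact add_le_add (div_sq_add_sq_le hh hr (by linarith)) (div_sq_add_sq_le hh hq (by linarith))
  have hb : |h ^ 2 / (‖ζ‖ ^ 2 + h ^ 2) ^ 2 - h ^ 2 / (‖ξ‖ ^ 2 + h ^ 2) ^ 2| ≤
      6 / (‖ζ‖ + h) * (12 * (h / (‖ζ‖ + h) ^ 2)) := by
    rw [← div_pow, ← div_pow, sq_sub_sq, abs_mul]
    gcongr
    · rw [abs_of_nonneg (by positivity)]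
      exact (add_le_add (div_sq_add_sq_le hh hr (by linarith))
        (div_sq_add_sq_le hh hq (by linarith))).trans hsum
    · refine le_trans (le_of_eq ?_) (abs_inv_sub_inv_mul_le hh hr hq hrq hh.le (by linarith))
      rw [← abs_of_pos hh, ← abs_mul, abs_of_pos hh]
      congr 1
      ring
  refine (add_le_add hb ha).trans (le_of_eq ?_)
  field_simp
  ring

/-! ### Cancellation -/

lemma integrable_regCauchyKernel_sq_sub {ε δ : ℝ} (hε : 0 < ε) (hδ : 0 < δ) :
    Integrable (fun ζ => regCauchyKernel ε ζ ^ 2 - regCauchyKernel δ ζ ^ 2) := by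
  have h1 := ((integrable_sq_div_sq_add_sq_sq hε).const_mul (|ε ^ 2 - δ ^ 2| / ε ^ 2)).add
    ((integrable_sq_div_sq_add_sq_sq hδ).const_mul (|ε ^ 2 - δ ^ 2| / δ ^ 2))
  refine h1.mono' ?_ (.of_forall fun ζ => ?_)
  · exact (((measurable_regCauchyKernel ε).pow_const 2).sub
      ((measurable_regCauchyKernel δ).pow_const 2)).aestronglyMeasurable
  · refine (norm_regCauchyKernel_sq_sub_le (by positivity) (by positivity)).trans ?_
    have hp : 0 < ‖ζ‖ ^ 2 + ε ^ 2 := by positivity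
    have hq : 0 < ‖ζ‖ ^ 2 + δ ^ 2 := by positivity
    simp only [Pi.add_apply]
    have e : ∀ η p : ℝ, 0 < η → |ε ^ 2 - δ ^ 2| / η ^ 2 * (η ^ 2 / p ^ 2) =
        |ε ^ 2 - δ ^ 2| * (p⁻¹) ^ 2 := fun η p hη => by field_simp
    rw [e ε _ hε, e δ _ hδ, div_eq_mul_inv, mul_inv]
    nlinarith [mul_nonneg (abs_nonneg (ε ^ 2 - δ ^ 2))
      (sq_nonneg ((‖ζ‖ ^ 2 + ε ^ 2)⁻¹ - (‖ζ‖ ^ 2 + δ ^ 2)⁻¹))]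

lemma integral_regCauchyKernel_sq_sub (ε δ : ℝ) :
    ∫ ζ, (regCauchyKernel ε ζ ^ 2 - regCauchyKernel δ ζ ^ 2) = 0 := by
  have hrot : MeasurePreserving (fun ζ : ℂ => Complex.I * ζ) := by
    exact (rotation ⟨Complex.I, by simp [Submonoid.unitSphere]⟩).measurePreserving
  have hI : ∀ ε ζ, regCauchyKernel ε (Complex.I * ζ) ^ 2 = - regCauchyKernel ε ζ ^ 2 := by
    intro ε ζ
    simp only [regCauchyKernel, Complex.real_smul, norm_mul, Complex.norm_I, one_mul, map_mul,
      Complex.conj_I, mul_pow, neg_sq, Complex.I_sq]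
    ring
  have := hrot.integral_comp (Homeomorph.mulLeft₀ Complex.I Complex.I_ne_zero).measurableEmbedding
    (fun ζ => regCauchyKernel ε ζ ^ 2 - regCauchyKernel δ ζ ^ 2)
  simp only [hI] at this
  simp only [← neg_sub' (regCauchyKernel ε _ ^ 2), integral_neg] at this
  exact self_eq_neg.1 this.symm

lemma integrable_regCauchyKernelDeriv_sub {ε δ : ℝ} (hε : 0 < ε) (hδ : 0 < δ) :
    Integrable (fun ζ => regCauchyKernelDeriv ε ζ - regCauchyKernelDeriv δ ζ) := by
  simp only [regCauchyKernelDeriv_sub]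
  exact (((integrable_sq_div_sq_add_sq_sq hε).sub
    (integrable_sq_div_sq_add_sq_sq hδ)).smul_const _).sub
      ((integrable_regCauchyKernel_sq_sub hε hδ).smul_const _)

lemma integral_regCauchyKernelDeriv_sub {ε δ : ℝ} (hε : 0 < ε) (hδ : 0 < δ) :
    ∫ ζ, (regCauchyKernelDeriv ε ζ - regCauchyKernelDeriv δ ζ) = 0 := by
  have hb : Integrable fun ζ : ℂ =>
      ε ^ 2 / (‖ζ‖ ^ 2 + ε ^ 2) ^ 2 - δ ^ 2 / (‖ζ‖ ^ 2 + δ ^ 2) ^ 2 :=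
    (integrable_sq_div_sq_add_sq_sq hε).sub (integrable_sq_div_sq_add_sq_sq hδ)
  simp only [regCauchyKernelDeriv_sub]
  rw [integral_sub (hb.smul_const _) ((integrable_regCauchyKernel_sq_sub hε hδ).smul_const _),
    integral_smul_const, integral_smul_const, integral_regCauchyKernel_sq_sub,
    integral_sub (integrable_sq_div_sq_add_sq_sq hε) (integrable_sq_div_sq_add_sq_sq hδ),
    integral_sq_div_sq_add_sq_sq hε, integral_sq_div_sq_add_sq_sq hδ]
  refine ContinuousLinearMap.ext fun e => ?_
  simp

/-! ### Regularised potentials -/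

/-- The convolution of `f` with the regularised Cauchy kernel. -/
noncomputable def regPotential (ε : ℝ) (f : ℂ → ℂ) (z : ℂ) : ℂ :=
  ∫ w, f w * regCauchyKernel ε (z - w)

/-- The convolution of `f` with the derivative of the regularised Cauchy kernel. -/
noncomputable def regPotentialDeriv (ε : ℝ) (f : ℂ → ℂ) (z : ℂ) : ℂ →L[ℝ] ℂ :=
  ∫ w, f w • regCauchyKernelDeriv ε (z - w)

/-- The derivative of the unregularised potential, written as a correction of the regularised
one at scale `1` by an absolutely convergent integral. -/
noncomputable def potentialDeriv (f : ℂ → ℂ) (z : ℂ) : ℂ →L[ℝ] ℂ :=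
  regPotentialDeriv 1 f z +
    ∫ w, (f w - f z) • (regCauchyKernelDeriv 0 (z - w) - regCauchyKernelDeriv 1 (z - w))

lemma continuous_of_holder_bound {f : ℂ → ℂ} {α H : ℝ} (hα : 0 < α)
    (hH : ∀ z z', ‖f z - f z'‖ ≤ H * ‖z - z'‖ ^ α) : Continuous f := by
  refine continuous_iff_continuousAt.2 fun z => tendsto_iff_norm_sub_tendsto_zero.2 ?_
  have h : Continuous fun w : ℂ => H * ‖w - z‖ ^ α :=
    continuous_const.mul ((by fun_prop : Continuous fun w : ℂ => ‖w - z‖).rpow_const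
      fun _ => Or.inr hα.le)
  have h0 := h.tendsto z
  simp only [sub_self, norm_zero, Real.zero_rpow hα.ne', mul_zero] at h0
  exact squeeze_zero (fun _ => norm_nonneg _) (fun w => hH w z) h0

lemma holder_bound_nonneg {f : ℂ → ℂ} {α H : ℝ}
    (hH : ∀ z z', ‖f z - f z'‖ ≤ H * ‖z - z'‖ ^ α) : 0 ≤ H := by
  simpa using (norm_nonneg _).trans (hH 1 0)

lemma hasFDerivAt_regPotential {ε : ℝ} (hε : 0 < ε) {f : ℂ → ℂ} (hf : Continuous f)
    (hc : HasCompactSupport f) (z : ℂ) :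
    HasFDerivAt (regPotential ε f) (regPotentialDeriv ε f z) z := by
  have hK := continuous_regCauchyKernel hε
  have hK' := continuous_regCauchyKernelDeriv hε
  have hF : ∀ z, Continuous fun w => f w * regCauchyKernel ε (z - w) := fun z => by fun_prop
  have hF' : Continuous fun w => f w • regCauchyKernelDeriv ε (z - w) := by fun_prop
  refine hasFDerivAt_integral_of_dominated_of_fderiv_le
    (F' := fun z w => f w • regCauchyKernelDeriv ε (z - w))
    (bound := fun w => ‖f w‖ * (1 / ε ^ 2)) Filter.univ_mem
    (.of_forall fun z => (hF z).aestronglyMeasurable)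
    ((hF z).integrable_of_hasCompactSupport hc.mul_right) hF'.aestronglyMeasurable
    (.of_forall fun w z _ => ?_)
    ((hf.integrable_of_hasCompactSupport hc).norm.mul_const _)
    (.of_forall fun w z _ => ?_)
  · rw [norm_smul]
    gcongr
    exact norm_regCauchyKernelDeriv_le hε _
  · exact ((hasFDerivAt_comp_sub w).2 (hasFDerivAt_regCauchyKernel hε (z - w))).const_mul (f w)

lemma norm_regPotential_sub_zero_le {ε M : ℝ} (hε : 0 < ε) {f : ℂ → ℂ} (hf : Continuous f)
    (hc : HasCompactSupport f) (hM : ∀ z, ‖f z‖ ≤ M) (z : ℂ) :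
    ‖regPotential ε f z - regPotential 0 f z‖ ≤
      M * (ε * ∫ ζ : ℂ, ‖ζ‖ ^ (1 : ℝ) / (‖ζ‖ ^ 2 * (‖ζ‖ ^ 2 + 1))) := by
  have hM0 : 0 ≤ M := (norm_nonneg _).trans (hM 0)
  have hK := continuous_regCauchyKernel hε
  have hdom := ((integrable_norm_rpow_mul_sq_div (β := 1) one_pos one_lt_two hε).comp_sub_left
    z).const_mul M
  have hle : ∀ᵐ w, ‖f w * regCauchyKernel ε (z - w) - f w * regCauchyKernel 0 (z - w)‖ ≤
      M * (‖z - w‖ ^ (1 : ℝ) * (ε ^ 2 / (‖z - w‖ ^ 2 * (‖z - w‖ ^ 2 + ε ^ 2)))) := by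
    filter_upwards [Measure.ae_ne volume z] with w hw
    have hn : 0 < ‖z - w‖ := norm_pos_iff.2 (sub_ne_zero.2 hw.symm)
    rw [← mul_sub, norm_mul, regCauchyKernel_sub (by positivity) (by positivity), Real.rpow_one,
      zero_pow two_ne_zero, sub_zero, add_zero, abs_of_nonneg (by positivity),
      mul_comm (‖z - w‖ ^ 2 + ε ^ 2)]
    gcongr
    exact hM w
  have h1 : Integrable fun w => f w * regCauchyKernel ε (z - w) :=
    (by fun_prop : Continuous _).integrable_of_hasCompactSupport hc.mul_right
  have hmeas : Measurable fun w => f w * regCauchyKernel 0 (z - w) := by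
    have := measurable_regCauchyKernel 0
    have := hf.measurable
    fun_prop
  have hd := hdom.mono' (h1.aestronglyMeasurable.sub hmeas.aestronglyMeasurable) hle
  have h2 : Integrable fun w => f w * regCauchyKernel 0 (z - w) := by
    simpa using h1.sub hd
  rw [regPotential, regPotential, ← integral_sub h1 h2]
  refine (norm_integral_le_of_norm_le hdom hle).trans (le_of_eq ?_)
  rw [integral_const_mul, integral_sub_left_eq_self
    (fun ζ : ℂ => ‖ζ‖ ^ (1 : ℝ) * (ε ^ 2 / (‖ζ‖ ^ 2 * (‖ζ‖ ^ 2 + ε ^ 2)))),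
    integral_norm_rpow_mul_sq_div hε, Real.rpow_one]

section

variable {E : Type*} [NormedAddCommGroup E] [NormedSpace ℂ E]

lemma integrable_smul_of_hasCompactSupport {f : ℂ → ℂ} {k : ℂ → E} (hf : Continuous f)
    (hc : HasCompactSupport f) (hk : Continuous k) : Integrable fun w => f w • k w :=
  (hf.smul hk).integrable_of_hasCompactSupport hc.smul_right

variable [NormedSpace ℝ E]

lemma integral_smul_sub_integral_smul_eq [SMulCommClass ℝ ℂ E] {X : Type*} [MeasurableSpace X] {μ : Measure X}
    {f : X → ℂ} {k k' : X → E} (c : ℂ)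
    (h1 : Integrable (fun x => f x • k x) μ) (h2 : Integrable (fun x => f x • k' x) μ)
    (hk : Integrable (fun x => k x - k' x) μ) (h0 : ∫ x, (k x - k' x) ∂μ = 0) :
    Integrable (fun x => (f x - c) • (k x - k' x)) μ ∧
    (∫ x, f x • k x ∂μ) - ∫ x, f x • k' x ∂μ = ∫ x, (f x - c) • (k x - k' x) ∂μ := by
  have h : ∀ x, (f x - c) • (k x - k' x) = f x • k x - f x • k' x - c • (k x - k' x) :=
    fun x => by rw [sub_smul, smul_sub (f x)]
  simp only [h]
  have h12 : Integrable (fun x => f x • k x - f x • k' x) μ := h1.sub h2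
  have h3 : Integrable (fun x => c • (k x - k' x)) μ := hk.smul c
  refine ⟨h12.sub h3, ?_⟩
  rw [integral_sub h12 h3, integral_sub h1 h2, integral_smul, h0, smul_zero, sub_zero]

lemma integral_smul_sub_integral_smul_sub {X : Type*} [MeasurableSpace X] {μ : Measure X}
    {g : X → ℂ} {a b c : X → E} (hac : Integrable (fun x => g x • (a x - c x)) μ)
    (hcb : Integrable (fun x => g x • (c x - b x)) μ) :
    (∫ x, g x • (a x - c x) ∂μ) - ∫ x, g x • (b x - c x) ∂μ =
      ∫ x, g x • (a x - b x) ∂μ := by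
  have hbc : Integrable (fun x => g x • (b x - c x)) μ :=
    hcb.neg.congr (.of_forall fun x => by simp [← smul_neg])
  rw [← integral_sub hac hbc]
  simp only [← smul_sub, sub_sub_sub_cancel_right]

end

lemma integral_even_sub_even_eq_zero {E : Type*} [NormedAddCommGroup E] [NormedSpace ℝ E]
    {k : ℂ → E} (heven : ∀ ζ, k (-ζ) = k ζ) (z z' : ℂ) :
    ∫ w, (k (z - w) - k (z' - w)) = 0 := by
  have hr := integral_sub_left_eq_self (fun w => k (z - w) - k (z' - w)) volume (z + z')
  have h1 : ∀ w, z - (z + z' - w) = -(z' - w) := fun w => by ring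
  have h2 : ∀ w, z' - (z + z' - w) = -(z - w) := fun w => by ring
  simp only [h1, h2, heven] at hr
  simp only [← neg_sub (k (z - _)), integral_neg] at hr
  rw [neg_eq_iff_add_eq_zero, ← two_smul ℝ] at hr
  exact (smul_eq_zero.1 hr).resolve_left two_ne_zero

lemma regPotentialDeriv_sub_eq {ε δ : ℝ} (hε : 0 < ε) (hδ : 0 < δ) {f : ℂ → ℂ}
    (hf : Continuous f) (hc : HasCompactSupport f) (z : ℂ) :
    Integrable (fun w => (f w - f z) •
      (regCauchyKernelDeriv ε (z - w) - regCauchyKernelDeriv δ (z - w))) ∧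
    regPotentialDeriv ε f z - regPotentialDeriv δ f z =
      ∫ w, (f w - f z) • (regCauchyKernelDeriv ε (z - w) - regCauchyKernelDeriv δ (z - w)) := by
  have hint : ∀ ε, 0 < ε → Integrable fun w => f w • regCauchyKernelDeriv ε (z - w) :=
    fun ε hε => integrable_smul_of_hasCompactSupport hf hc
      ((continuous_regCauchyKernelDeriv hε).comp (by fun_prop))
  refine integral_smul_sub_integral_smul_eq (f z) (hint ε hε) (hint δ hδ)
    ((integrable_regCauchyKernelDeriv_sub hε hδ).comp_sub_left z) ?_
  exact (integral_sub_left_eq_self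
    (fun ζ => regCauchyKernelDeriv ε ζ - regCauchyKernelDeriv δ ζ) volume z).trans
    (integral_regCauchyKernelDeriv_sub hε hδ)

lemma norm_potentialDeriv_sub_le {ε α H : ℝ} (hε : 0 < ε) (hα : α ∈ Set.Ioo (0 : ℝ) 1)
    {f : ℂ → ℂ} (hc : HasCompactSupport f)
    (hH : ∀ z z', ‖f z - f z'‖ ≤ H * ‖z - z'‖ ^ α) (z : ℂ) :
    ‖regPotentialDeriv ε f z - potentialDeriv f z‖ ≤
      3 * H * (ε ^ α * ∫ ζ : ℂ, ‖ζ‖ ^ α / (‖ζ‖ ^ 2 * (‖ζ‖ ^ 2 + 1))) := by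
  have hf := continuous_of_holder_bound hα.1 hH
  have hH0 := holder_bound_nonneg hH
  have hdom : ∀ ε, 0 < ε → Integrable fun w => 3 * H *
      (‖z - w‖ ^ α * (ε ^ 2 / (‖z - w‖ ^ 2 * (‖z - w‖ ^ 2 + ε ^ 2)))) := fun ε hε =>
    ((integrable_norm_rpow_mul_sq_div hα.1 (hα.2.trans one_lt_two) hε).comp_sub_left z).const_mul
      (3 * H)
  have hle : ∀ ε, 0 < ε → ∀ᵐ w, ‖(f w - f z) •
      (regCauchyKernelDeriv ε (z - w) - regCauchyKernelDeriv 0 (z - w))‖ ≤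
      3 * H * (‖z - w‖ ^ α * (ε ^ 2 / (‖z - w‖ ^ 2 * (‖z - w‖ ^ 2 + ε ^ 2)))) := by
    intro ε hε
    filter_upwards [Measure.ae_ne volume z] with w hw
    rw [norm_smul]
    calc _ ≤ (H * ‖w - z‖ ^ α) * (3 * (ε ^ 2 / (‖z - w‖ ^ 2 * (‖z - w‖ ^ 2 + ε ^ 2)))) := by
          gcongr
          · exact hH w z
          · exact norm_regCauchyKernelDeriv_sub_zero_le hε _ (sub_ne_zero.2 hw.symm)
      _ = _ := by rw [norm_sub_rev w z]; ring
  have hint : ∀ ε, 0 < ε → Integrable fun w => (f w - f z) •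
      (regCauchyKernelDeriv ε (z - w) - regCauchyKernelDeriv 0 (z - w)) := fun ε hε => by
    refine (hdom ε hε).mono' (AEStronglyMeasurable.smul
      (by fun_prop : Continuous fun w => f w - f z).aestronglyMeasurable ?_) (hle ε hε)
    have hs : Measurable fun w : ℂ => z - w := by fun_prop
    exact (((stronglyMeasurable_regCauchyKernelDeriv ε).comp_measurable hs).sub
      ((stronglyMeasurable_regCauchyKernelDeriv 0).comp_measurable hs)).aestronglyMeasurable
  obtain ⟨hi, he⟩ := regPotentialDeriv_sub_eq hε one_pos hf hc z
  have key : regPotentialDeriv ε f z - potentialDeriv f z =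
      ∫ w, (f w - f z) • (regCauchyKernelDeriv ε (z - w) - regCauchyKernelDeriv 0 (z - w)) := by
    rw [potentialDeriv, ← sub_sub, he]
    exact integral_smul_sub_integral_smul_sub hi (hint 1 one_pos)
  rw [key]
  refine (norm_integral_le_of_norm_le (hdom ε hε) (hle ε hε)).trans (le_of_eq ?_)
  rw [integral_const_mul, integral_sub_left_eq_self
    (fun ζ : ℂ => ‖ζ‖ ^ α * (ε ^ 2 / (‖ζ‖ ^ 2 * (‖ζ‖ ^ 2 + ε ^ 2)))),
    integral_norm_rpow_mul_sq_div hε]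

lemma norm_regPotentialDeriv_sub_le {α H : ℝ} (hα : α ∈ Set.Ioo (0 : ℝ) 1)
    {f : ℂ → ℂ} (hc : HasCompactSupport f)
    (hH : ∀ z z', ‖f z - f z'‖ ≤ H * ‖z - z'‖ ^ α) {z z' : ℂ} (hz : z ≠ z') :
    ‖regPotentialDeriv ‖z - z'‖ f z - regPotentialDeriv ‖z - z'‖ f z'‖ ≤
      156 * H * (‖z - z'‖ ^ α * ∫ ζ : ℂ, ‖ζ‖ ^ α / (‖ζ‖ + 1) ^ 3) := by
  have hf := continuous_of_holder_bound hα.1 hH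
  have hH0 := holder_bound_nonneg hH
  have hh : 0 < ‖z - z'‖ := norm_pos_iff.2 (sub_ne_zero.2 hz)
  obtain ⟨h, hdef⟩ : ∃ h, h = ‖z - z'‖ := ⟨_, rfl⟩
  rw [← hdef] at hh ⊢
  have hk := continuous_regCauchyKernelDeriv hh
  have hk_le : ∀ w, ‖regCauchyKernelDeriv h (z - w) - regCauchyKernelDeriv h (z' - w)‖ ≤
      156 * (h / (‖z - w‖ + h) ^ 3) := fun w =>
    norm_regCauchyKernelDeriv_sub_le_of_norm_sub_le hh (by rw [sub_sub_sub_cancel_right, hdef])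
  have hint : ∀ z, Integrable fun w => f w • regCauchyKernelDeriv h (z - w) := fun z =>
    integrable_smul_of_hasCompactSupport hf hc (hk.comp (by fun_prop))
  have hkint : Integrable fun w =>
      regCauchyKernelDeriv h (z - w) - regCauchyKernelDeriv h (z' - w) := by
    have hd := ((integrable_norm_rpow_mul_div_cube le_rfl one_pos hh).comp_sub_left z).const_mul 156
    simp only [Real.rpow_zero, one_mul] at hd
    exact hd.mono' (by fun_prop : Continuous _).aestronglyMeasurable (.of_forall hk_le)
  have hzero : ∫ w, (regCauchyKernelDeriv h (z - w) - regCauchyKernelDeriv h (z' - w)) = 0 :=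
    integral_even_sub_even_eq_zero
      (fun ζ => by simp [regCauchyKernelDeriv, regCauchyKernel]) z z'
  have key : regPotentialDeriv h f z - regPotentialDeriv h f z' =
      ∫ w, (f w - f z) • (regCauchyKernelDeriv h (z - w) - regCauchyKernelDeriv h (z' - w)) :=
    (integral_smul_sub_integral_smul_eq (f z) (hint z) (hint z') hkint hzero).2
  have hdom := ((integrable_norm_rpow_mul_div_cube hα.1.le hα.2 hh).comp_sub_left z).const_mul
    (156 * H)
  rw [key]
  refine (norm_integral_le_of_norm_le hdom (.of_forall fun w => ?_)).trans (le_of_eq ?_)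
  · rw [norm_smul]
    calc _ ≤ (H * ‖w - z‖ ^ α) * (156 * (h / (‖z - w‖ + h) ^ 3)) := by
          gcongr
          · exact hH w z
          · exact hk_le w
      _ = _ := by rw [norm_sub_rev w z]; ring
  · rw [integral_const_mul, integral_sub_left_eq_self
      (fun ζ : ℂ => ‖ζ‖ ^ α * (h / (‖ζ‖ + h) ^ 3)), integral_norm_rpow_mul_div_cube hh]

lemma norm_regPotentialDeriv_one_le {M : ℝ} {f : ℂ → ℂ}
    (hs : ∀ z ∉ Metric.closedBall (0 : ℂ) 1, f z = 0) (hM : ∀ z, ‖f z‖ ≤ M) (z : ℂ) :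
    ‖regPotentialDeriv 1 f z‖ ≤ Real.pi * M := by
  rw [regPotentialDeriv, ← setIntegral_eq_integral_of_forall_compl_eq_zero
    (s := Metric.closedBall (0 : ℂ) 1) fun w hw => by
      rw [hs w hw]
      exact zero_smul ℂ (regCauchyKernelDeriv 1 (z - w))]
  have hfin : volume (Metric.closedBall (0 : ℂ) 1) < ⊤ := measure_closedBall_lt_top
  refine (norm_setIntegral_le_of_norm_le_const (C := M) hfin fun w _ => ?_).trans (le_of_eq ?_)
  · rw [norm_smul]
    have := norm_regCauchyKernelDeriv_le one_pos (z - w)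
    rw [one_pow, div_one] at this
    exact (mul_le_of_le_one_right (norm_nonneg _) this).trans (hM w)
  · rw [measureReal_def, Complex.volume_closedBall]
    simp [mul_comm]

lemma norm_potentialDeriv_le {α M H : ℝ} (hα : α ∈ Set.Ioo (0 : ℝ) 1) {f : ℂ → ℂ}
    (hs : ∀ z ∉ Metric.closedBall (0 : ℂ) 1, f z = 0) (hM : ∀ z, ‖f z‖ ≤ M)
    (hH : ∀ z z', ‖f z - f z'‖ ≤ H * ‖z - z'‖ ^ α) (z : ℂ) :
    ‖potentialDeriv f z‖ ≤
      Real.pi * M + 3 * H * ∫ ζ : ℂ, ‖ζ‖ ^ α / (‖ζ‖ ^ 2 * (‖ζ‖ ^ 2 + 1)) := by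
  have hc := HasCompactSupport.intro (isCompact_closedBall (0 : ℂ) 1) fun z hz => hs z hz
  have h1 := norm_potentialDeriv_sub_le one_pos hα hc hH z
  rw [Real.one_rpow, one_mul] at h1
  exact (norm_le_norm_add_norm_sub _ _).trans
    (add_le_add (norm_regPotentialDeriv_one_le hs hM z) h1)

lemma norm_potentialDeriv_sub_potentialDeriv_le {α H : ℝ} (hα : α ∈ Set.Ioo (0 : ℝ) 1)
    {f : ℂ → ℂ} (hc : HasCompactSupport f)
    (hH : ∀ z z', ‖f z - f z'‖ ≤ H * ‖z - z'‖ ^ α) (z z' : ℂ) :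
    ‖potentialDeriv f z - potentialDeriv f z'‖ ≤
      H * (6 * (∫ ζ : ℂ, ‖ζ‖ ^ α / (‖ζ‖ ^ 2 * (‖ζ‖ ^ 2 + 1))) +
        156 * ∫ ζ : ℂ, ‖ζ‖ ^ α / (‖ζ‖ + 1) ^ 3) * ‖z - z'‖ ^ α := by
  rcases eq_or_ne z z' with rfl | hz
  · simp [Real.zero_rpow hα.1.ne']
  have hh : 0 < ‖z - z'‖ := norm_pos_iff.2 (sub_ne_zero.2 hz)
  have h1 := norm_potentialDeriv_sub_le hh hα hc hH z
  have h2 := norm_potentialDeriv_sub_le hh hα hc hH z'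
  have h3 := norm_regPotentialDeriv_sub_le hα hc hH hz
  rw [norm_sub_rev] at h1
  calc _ = ‖(potentialDeriv f z - regPotentialDeriv ‖z - z'‖ f z) +
        (regPotentialDeriv ‖z - z'‖ f z - regPotentialDeriv ‖z - z'‖ f z') +
        (regPotentialDeriv ‖z - z'‖ f z' - potentialDeriv f z')‖ := by congr 1; abel
    _ ≤ _ := norm_add₃_le.trans (by linarith)

lemma hasFDerivAt_regPotential_zero {α M H : ℝ} (hα : α ∈ Set.Ioo (0 : ℝ) 1) {f : ℂ → ℂ}
    (hc : HasCompactSupport f) (hM : ∀ z, ‖f z‖ ≤ M)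
    (hH : ∀ z z', ‖f z - f z'‖ ≤ H * ‖z - z'‖ ^ α) (z : ℂ) :
    HasFDerivAt (regPotential 0 f) (potentialDeriv f z) z := by
  have hf := continuous_of_holder_bound hα.1 hH
  have hε : ∀ n : ℕ, (0 : ℝ) < 1 / ((n : ℝ) + 1) := fun n => by positivity
  have hlim := tendsto_one_div_add_atTop_nhds_zero_nat (𝕜 := ℝ)
  refine hasFDerivAt_of_tendstoUniformly (l := Filter.atTop)
    (f := fun n : ℕ => regPotential (1 / ((n : ℝ) + 1)) f)
    (f' := fun n : ℕ => regPotentialDeriv (1 / ((n : ℝ) + 1)) f) ?_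
    (fun n x => hasFDerivAt_regPotential (hε n) hf hc x) (fun x => ?_) z
  · have h0 : Filter.Tendsto (fun n : ℕ => 3 * H * ((1 / ((n : ℝ) + 1)) ^ α *
        ∫ ζ : ℂ, ‖ζ‖ ^ α / (‖ζ‖ ^ 2 * (‖ζ‖ ^ 2 + 1)))) Filter.atTop (nhds 0) := by
      have := ((hlim.rpow_const (p := α) (Or.inr hα.1.le)).mul_const
        (∫ ζ : ℂ, ‖ζ‖ ^ α / (‖ζ‖ ^ 2 * (‖ζ‖ ^ 2 + 1)))).const_mul (3 * H)
      simpa [Real.zero_rpow hα.1.ne'] using this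
    rw [Metric.tendstoUniformly_iff]
    intro η hη
    filter_upwards [h0.eventually_lt_const hη] with n hn x
    rw [dist_comm, dist_eq_norm]
    exact (norm_potentialDeriv_sub_le (hε n) hα hc hH x).trans_lt hn
  · refine tendsto_iff_norm_sub_tendsto_zero.2 (squeeze_zero (fun _ => norm_nonneg _)
      (fun n => norm_regPotential_sub_zero_le (hε n) hf hc hM x) ?_)
    simpa using (hlim.mul_const
      (∫ ζ : ℂ, ‖ζ‖ ^ (1 : ℝ) / (‖ζ‖ ^ 2 * (‖ζ‖ ^ 2 + 1)))).const_mul M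

/-! ### The Cauchy–Green operator -/

lemma cauchyGreen_eq_regPotential_zero {f : ℂ → ℂ}
    (hs : ∀ z ∉ Metric.closedBall (0 : ℂ) 1, f z = 0) (z : ℂ) :
    cauchyGreen f z = (Real.pi⁻¹ : ℝ) • regPotential 0 f z := by
  have h : ∫ w in Metric.ball (0 : ℂ) 1, f w / (w - z) = ∫ w, f w / (w - z) := by
    refine setIntegral_eq_integral_of_ae_compl_eq_zero ?_
    have hsph := measure_eq_zero_iff_ae_notMem.1
      (Measure.addHaar_sphere (volume : Measure ℂ) 0 1)
    filter_upwards [hsph] with w hw hwb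
    rw [hs w, zero_div]
    rw [← Metric.ball_union_sphere]
    exact fun h => h.elim hwb hw
  rw [cauchyGreen, h, regPotential, Complex.real_smul, neg_mul, ← mul_neg, ← integral_neg]
  push_cast
  rw [one_div]
  congr 2
  ext w
  rw [regCauchyKernel_zero, ← neg_sub w z, inv_neg, mul_neg, div_eq_mul_inv]

lemma norm_half_mul_add_I_mul_le (L : ℂ →L[ℝ] ℂ) :
    ‖(1 / 2 : ℂ) * (L 1 + Complex.I * L Complex.I)‖ ≤ ‖L‖ := by
  have h1 := L.le_opNorm 1
  have h2 := L.le_opNorm Complex.I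
  have h3 := norm_add_le (L 1) (Complex.I * L Complex.I)
  simp only [norm_mul, Complex.norm_I, norm_one, mul_one, one_mul] at h1 h2 h3 ⊢
  norm_num
  linarith

lemma norm_half_mul_sub_I_mul_le (L : ℂ →L[ℝ] ℂ) :
    ‖(1 / 2 : ℂ) * (L 1 - Complex.I * L Complex.I)‖ ≤ ‖L‖ := by
  have h1 := L.le_opNorm 1
  have h2 := L.le_opNorm Complex.I
  have h3 := norm_sub_le (L 1) (Complex.I * L Complex.I)
  simp only [norm_mul, Complex.norm_I, norm_one, mul_one, one_mul] at h1 h2 h3 ⊢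
  norm_num
  linarith

/-- the Cauchy–Green operator maps `C^α` boundedly into `C^{1,α}`
on the unit disk: `Pf` is continuously differentiable on `D` and both `∂(Pf)`
and `∂̄(Pf)` are bounded and `α`-Hölder with constants controlled by
`C·(sup|f| + Hölder constant of f)`. -/
theorem cauchyGreen_holder_to_C1alpha (α : ℝ) (hα : α ∈ Set.Ioo (0 : ℝ) 1) :
    ∃ C > 0, ∀ f : ℂ → ℂ, ∀ M H : ℝ,
      (∀ z : ℂ, z ∉ Metric.closedBall (0 : ℂ) 1 → f z = 0) →
      (∀ z, ‖f z‖ ≤ M) →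
      (∀ z z', ‖f z - f z'‖ ≤ H * ‖z - z'‖ ^ α) →
      ContDiffOn ℝ 1 (cauchyGreen f) (Metric.ball (0 : ℂ) 1) ∧
      (∀ z ∈ Metric.ball (0 : ℂ) 1,
        ‖dop (cauchyGreen f) z‖ ≤ C * (M + H) ∧
        ‖dbar (cauchyGreen f) z‖ ≤ C * (M + H)) ∧
      (∀ z ∈ Metric.ball (0 : ℂ) 1, ∀ z' ∈ Metric.ball (0 : ℂ) 1,
        ‖dop (cauchyGreen f) z - dop (cauchyGreen f) z'‖ ≤ C * (M + H) * ‖z - z'‖ ^ α ∧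
        ‖dbar (cauchyGreen f) z - dbar (cauchyGreen f) z'‖ ≤ C * (M + H) * ‖z - z'‖ ^ α) := by
  set A := ∫ ζ : ℂ, ‖ζ‖ ^ α / (‖ζ‖ ^ 2 * (‖ζ‖ ^ 2 + 1)) with hA
  set B := ∫ ζ : ℂ, ‖ζ‖ ^ α / (‖ζ‖ + 1) ^ 3 with hB
  have hA0 : 0 ≤ A := integral_nonneg fun ζ => by positivity
  have hB0 : 0 ≤ B := integral_nonneg fun ζ => by positivity
  have hpi := Real.pi_pos
  have hpi1 : Real.pi⁻¹ ≤ 1 := inv_le_one_of_one_le₀ (by linarith [Real.pi_gt_three])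
  refine ⟨Real.pi + 6 * A + 156 * B, by positivity, fun f M H hs hM hH => ?_⟩
  have hM0 : 0 ≤ M := (norm_nonneg _).trans (hM 0)
  have hH0 := holder_bound_nonneg hH
  have hc : HasCompactSupport f :=
    HasCompactSupport.intro (isCompact_closedBall (0 : ℂ) 1) fun z hz => hs z hz
  have hderiv : ∀ z, HasFDerivAt (cauchyGreen f) (Real.pi⁻¹ • potentialDeriv f z) z := fun z => by
    rw [funext (cauchyGreen_eq_regPotential_zero hs)]
    exact (hasFDerivAt_regPotential_zero hα hc hM hH z).const_smul Real.pi⁻¹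
  have hfd : ∀ z, fderiv ℝ (cauchyGreen f) z = Real.pi⁻¹ • potentialDeriv f z :=
    fun z => (hderiv z).fderiv
  have hbound : ∀ z, ‖fderiv ℝ (cauchyGreen f) z‖ ≤ (Real.pi + 6 * A + 156 * B) * (M + H) := by
    intro z
    have h := norm_potentialDeriv_le hα hs hM hH z
    rw [hfd, norm_smul, Real.norm_of_nonneg (by positivity)]
    refine (mul_le_of_le_one_left (norm_nonneg _) hpi1).trans (h.trans ?_)
    rw [← hA]
    nlinarith [mul_nonneg hA0 hM0, mul_nonneg hA0 hH0, mul_nonneg hB0 hM0, mul_nonneg hB0 hH0,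
      mul_nonneg hpi.le hH0]
  have hholder : ∀ z z', ‖fderiv ℝ (cauchyGreen f) z - fderiv ℝ (cauchyGreen f) z'‖ ≤
      (Real.pi + 6 * A + 156 * B) * (M + H) * ‖z - z'‖ ^ α := by
    intro z z'
    have h := norm_potentialDeriv_sub_potentialDeriv_le hα hc hH z z'
    rw [hfd, hfd, ← smul_sub, norm_smul, Real.norm_of_nonneg (by positivity)]
    refine (mul_le_of_le_one_left (norm_nonneg _) hpi1).trans (h.trans ?_)
    rw [← hA, ← hB]
    refine mul_le_mul_of_nonneg_right ?_ (by positivity)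
    nlinarith [mul_nonneg hA0 hM0, mul_nonneg hB0 hM0, mul_nonneg hpi.le hH0,
      mul_nonneg hpi.le hM0]
  have hcont : Continuous (fderiv ℝ (cauchyGreen f)) := by
    refine continuous_iff_continuousAt.2 fun z => tendsto_iff_norm_sub_tendsto_zero.2 ?_
    have h : Continuous fun w : ℂ => (Real.pi + 6 * A + 156 * B) * (M + H) * ‖w - z‖ ^ α :=
      continuous_const.mul ((by fun_prop : Continuous fun w : ℂ => ‖w - z‖).rpow_const
        fun _ => Or.inr hα.1.le)
    have h0 := h.tendsto z
    simp only [sub_self, norm_zero, Real.zero_rpow hα.1.ne', mul_zero] at h0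
    exact squeeze_zero (fun _ => norm_nonneg _) (fun w => hholder w z) h0
  refine ⟨(contDiff_one_iff_fderiv.2 ⟨fun z => (hderiv z).differentiableAt, hcont⟩).contDiffOn,
    fun z _ => ⟨(norm_half_mul_sub_I_mul_le _).trans (hbound z),
      (norm_half_mul_add_I_mul_le _).trans (hbound z)⟩,
    fun z _ z' _ => ⟨le_trans (le_of_eq ?_) ((norm_half_mul_sub_I_mul_le _).trans (hholder z z')),
      le_trans (le_of_eq ?_) ((norm_half_mul_add_I_mul_le _).trans (hholder z z'))⟩⟩
  · rw [dop, dop, sub_apply, sub_apply]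
    congr 1
    ring
  · rw [dbar, dbar, sub_apply, sub_apply]
    congr 1
    ring
end
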